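/- arXiv:2208.06629 — 2 statements merged into one kernel-verified Lean document; each statement's English description precedes it below -/
import Mathlib

section
/- For every integer k ≥ 3, U_3(2k) ≤ 5k − 3, and for every integer k ≥ 4, U_4(2k) ≤ 7k − 5. -/
open scoped BigOperators

/-- A lazy transposition on `n` positions, encoded as a triple `(a, b, p)`. -/
abbrev LazyT (n : ℕ) := Fin n × Fin n × ℝ

/-- The triple `(a, b, p)` is a valid lazy transposition: `a ≠ b` and `p ∈ [0,1]`. -/
def LazyT.Valid {n : ℕ} (e : LazyT n) : Prop :=
  e.1 ≠ e.2.1 ∧ 0 ≤ e.2.2 ∧ e.2.2 ≤ 1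

/-- A star transposition: its first coordinate is position `1` (index `0` in `Fin n`). -/
def LazyT.IsStar {n : ℕ} (e : LazyT n) : Prop := (e.1 : ℕ) = 0

/-- `permDist L σ` is the probability that the composition of the independent lazy
transpositions in `L` (applied in order) equals the permutation `σ`. -/
noncomputable def permDist {n : ℕ} : List (LazyT n) → Equiv.Perm (Fin n) → ℝ
  | [], σ => if σ = 1 then 1 else 0
  | e :: L, σ =>
      e.2.2 * permDist L (σ * Equiv.swap e.1 e.2.1) + (1 - e.2.2) * permDist L σ

/-- `L` is a transposition shuffle on `n` points: all entries are valid lazy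
transpositions and the composition is uniformly distributed on `Perm (Fin n)`. -/
def IsShuffle {n : ℕ} (L : List (LazyT n)) : Prop :=
  (∀ e ∈ L, e.Valid) ∧
  ∀ σ : Equiv.Perm (Fin n), permDist L σ = 1 / (n.factorial : ℝ)

/-- `U n` is the minimum length of a transposition shuffle on `n` points. -/
noncomputable def U (n : ℕ) : ℕ :=
  sInf { ℓ : ℕ | ∃ L : List (LazyT n), L.length = ℓ ∧ IsShuffle L }

/-- The probability that, after applying the lazy transpositions in `L`, the `t`
labelled counters starting in positions `1, …, t` end up placed according to the
map `f` (counter `i` in position `f i`). -/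
noncomputable def placeProb {n t : ℕ} (ht : t ≤ n) (L : List (LazyT n))
    (f : Fin t → Fin n) : ℝ :=
  ∑ σ : Equiv.Perm (Fin n),
    if ∀ i : Fin t, σ (Fin.castLE ht i) = f i then permDist L σ else 0

/-- `L` is a `(t,n)`-shuffle: all entries are valid and the final placement of the
`t` counters is uniform over all `n!/(n-t)!` injections. -/
def IsTShuffle {n t : ℕ} (ht : t ≤ n) (L : List (LazyT n)) : Prop :=
  (∀ e ∈ L, e.Valid) ∧
  ∀ f : Fin t → Fin n, Function.Injective f →
    placeProb ht L f = ((n - t).factorial : ℝ) / (n.factorial : ℝ)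

/-- `Ut t n` is the minimum length of a `(t,n)`-shuffle. -/
noncomputable def Ut (t n : ℕ) : ℕ :=
  sInf { ℓ : ℕ | ∃ (ht : t ≤ n) (L : List (LazyT n)), L.length = ℓ ∧ IsTShuffle ht L }

/-- The probability that after applying `L` the set of positions occupied by the
`t` (indistinguishable) counters starting in positions `1, …, t` is exactly `S`. -/
noncomputable def occProb {n t : ℕ} (ht : t ≤ n) (L : List (LazyT n))
    (S : Finset (Fin n)) : ℝ :=
  ∑ σ : Equiv.Perm (Fin n),
    if Finset.image (fun i : Fin t => σ (Fin.castLE ht i)) Finset.univ = S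
    then permDist L σ else 0

/-- `L` shuffles `t` indistinguishable counters over `n` positions: all entries are
valid and the occupied set is uniform over all `n.choose t` subsets of size `t`. -/
def IsIndShuffle {n t : ℕ} (ht : t ≤ n) (L : List (LazyT n)) : Prop :=
  (∀ e ∈ L, e.Valid) ∧
  ∀ S : Finset (Fin n), S.card = t → occProb ht L S = 1 / (n.choose t : ℝ)

/-- `Uhat t n` is the minimum length of a sequence of lazy transpositions shuffling
`t` indistinguishable counters uniformly over `n` positions. -/
noncomputable def Uhat (t n : ℕ) : ℕ :=
  sInf { ℓ : ℕ | ∃ (ht : t ≤ n) (L : List (LazyT n)), L.length = ℓ ∧ IsIndShuffle ht L }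

/-- `Ustar n` is the minimum length of a transposition shuffle on `n` points all of
whose lazy transpositions are star transpositions. -/
noncomputable def Ustar (n : ℕ) : ℕ :=
  sInf { ℓ : ℕ | ∃ L : List (LazyT n), L.length = ℓ ∧ IsShuffle L ∧ ∀ e ∈ L, e.IsStar }

/-- `Utstar t n` is the minimum length of a `(t,n)`-shuffle all of whose lazy
transpositions are star transpositions. -/
noncomputable def Utstar (t n : ℕ) : ℕ :=
  sInf { ℓ : ℕ | ∃ (ht : t ≤ n) (L : List (LazyT n)),
    L.length = ℓ ∧ IsTShuffle ht L ∧ ∀ e ∈ L, e.IsStar }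

set_option linter.unusedSectionVars false

namespace UtD
open Equiv

/-- Backward evolution operator of a list of lazy transpositions. -/
noncomputable def Tt {α X : Type*} [DecidableEq α] [SMul (Perm α) X] :
    List (α × α × ℝ) → (X → ℝ) → X → ℝ
  | [], F, x => F x
  | e :: L, F, x => e.2.2 * Tt L F (swap e.1 e.2.1 • x) + (1 - e.2.2) * Tt L F x

section
variable {α X : Type*} [DecidableEq α] [MulAction (Perm α) X]

lemma Tt_append (L M : List (α × α × ℝ)) (F : X → ℝ) (x : X) :
    Tt (L ++ M) F x = Tt L (Tt M F) x := by
  induction L generalizing x with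
  | nil => rfl
  | cons e L ih => simp only [List.cons_append, Tt, ih]

/-- Star list. -/
noncomputable def star (a : α) : List α → List (α × α × ℝ)
  | [] => []
  | b :: l => (a, b, 1 / ((l.length : ℝ) + 2)) :: star a l

lemma star_length (a : α) (l : List α) : (star a l).length = l.length := by
  induction l with
  | nil => rfl
  | cons b l ih => simp [star, ih]

lemma star_valid (a : α) (l : List α) (h : a ∉ l) :
    ∀ e ∈ star a l, e.1 ≠ e.2.1 ∧ 0 ≤ e.2.2 ∧ e.2.2 ≤ 1 := by
  induction l with
  | nil => simp [star]
  | cons b l ih =>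
    simp only [List.mem_cons, not_or] at h
    intro e he
    simp only [star, List.mem_cons] at he
    rcases he with rfl | he
    · refine ⟨h.1, by positivity, ?_⟩
      simp only
      rw [div_le_one (by positivity)]
      have : (0:ℝ) ≤ l.length := by positivity
      linarith
    · exact ih h.2 e he

lemma star_mem (a : α) (l : List α) :
    ∀ e ∈ star a l, e.1 = a ∧ e.2.1 ∈ l := by
  induction l with
  | nil => simp [star]
  | cons b l ih =>
    intro e he
    simp only [star, List.mem_cons] at he
    rcases he with rfl | he
    · simp
    · have := ih e he
      simp [this]

lemma star_fix (a c : α) (l : List α) (hc : c ≠ a) (hl : c ∉ l) (φ : α → ℝ) :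
    Tt (star a l) φ c = φ c := by
  induction l with
  | nil => rfl
  | cons b l ih =>
    simp only [List.mem_cons, not_or] at hl
    simp only [star, Tt, Perm.smul_def]
    rw [swap_apply_of_ne_of_ne hc hl.1, ih hl.2]
    ring

lemma star_avg (a : α) (l : List α) (hl : (a :: l).Nodup) (φ : α → ℝ) :
    Tt (star a l) φ a * ((l.length : ℝ) + 1) = φ a + (l.map φ).sum := by
  induction l with
  | nil => simp [star, Tt]
  | cons b l ih =>
    simp only [List.nodup_cons, List.mem_cons, not_or] at hl
    have h1 := ih (by simp [hl])
    simp only [star, Tt, Perm.smul_def]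
    rw [swap_apply_left, star_fix a b l (Ne.symm hl.1.1) hl.2.1]
    simp only [List.length_cons, List.map_cons, List.sum_cons]
    have h2 : (l.length : ℝ) + 2 ≠ 0 := by positivity
    push_cast
    field_simp
    linear_combination ((l.length : ℝ) + 2) * h1

variable [Fintype α]

/-- Permutations supported in `A`. -/
def PS (A : Finset α) : Finset (Perm α) := Finset.univ.filter (fun ρ => ∀ x, x ∉ A → ρ x = x)

lemma mem_PS {A : Finset α} {ρ : Perm α} : ρ ∈ PS A ↔ ∀ x, x ∉ A → ρ x = x := by
  simp [PS]

lemma swap_mul_mem_PS {A : Finset α} {b c : α} (hb : b ∈ A) (hc : c ∈ A) {ρ : Perm α}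
    (h : ρ ∈ PS A) : swap b c * ρ ∈ PS A := by
  rw [mem_PS] at *
  intro x hx
  rw [Perm.mul_apply, h x hx, swap_apply_of_ne_of_ne] <;> (rintro rfl; exact hx ‹_›)

lemma PS_apply_mem {A : Finset α} {ρ : Perm α} (h : ρ ∈ PS A) {x : α} (hx : x ∈ A) :
    ρ x ∈ A := by
  by_contra hn
  have := mem_PS.1 h _ hn
  have := ρ.injective this
  rw [this] at hn
  exact hn hx

lemma one_mem_PS (A : Finset α) : (1 : Perm α) ∈ PS A := by simp [mem_PS]

lemma PS_card_pos (A : Finset α) : (0:ℝ) < ((PS A).card : ℝ) := by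
  exact_mod_cast Finset.card_pos.2 ⟨1, one_mem_PS A⟩

lemma fib_swap {A : Finset α} {a b c : α} (hb : b ∈ A) (hc : c ∈ A) (F : X → ℝ) (x : X) (j : α) :
    ∑ ρ ∈ (PS A).filter (fun ρ => ρ a = j), F (swap b c • ρ • x) =
    ∑ ρ ∈ (PS A).filter (fun ρ => ρ a = swap b c j), F (ρ • x) := by
  refine Finset.sum_bij' (fun ρ _ => swap b c * ρ) (fun ρ _ => swap b c * ρ) ?_ ?_ ?_ ?_ ?_
  · intro ρ h
    rw [Finset.mem_filter] at h ⊢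
    exact ⟨swap_mul_mem_PS hb hc h.1, by simp [h.2]⟩
  · intro ρ h
    rw [Finset.mem_filter] at h ⊢
    exact ⟨swap_mul_mem_PS hb hc h.1, by simp [h.2]⟩
  · intro ρ h; simp
  · intro ρ h; simp
  · intro ρ h; rw [mul_smul]

lemma fib_T {A : Finset α} {a : α} (L : List (α × α × ℝ)) (hL : ∀ e ∈ L, e.1 ∈ A ∧ e.2.1 ∈ A)
    (F : X → ℝ) (x : X) (j : α) :
    ∑ ρ ∈ (PS A).filter (fun ρ => ρ a = j), Tt L F (ρ • x) =
    Tt L (fun i => ∑ ρ ∈ (PS A).filter (fun ρ => ρ a = i), F (ρ • x)) j := by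
  induction L generalizing j with
  | nil => rfl
  | cons e L ih =>
    have h1 := hL e (by simp)
    have h2 := ih (fun e he => hL e (by simp [he]))
    simp only [Tt, Finset.sum_add_distrib, ← Finset.mul_sum]
    rw [fib_swap h1.1 h1.2 (Tt L F), h2, h2]
    rfl

lemma sum_fib {A : Finset α} {a : α} (ha : a ∈ A) (G : Perm α → ℝ) :
    ∑ j ∈ A, ∑ ρ ∈ (PS A).filter (fun ρ => ρ a = j), G ρ = ∑ ρ ∈ PS A, G ρ :=
  Finset.sum_fiberwise_of_maps_to (fun _ h => PS_apply_mem h ha) G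

lemma fib_self {A : Finset α} {a : α} :
    (PS A).filter (fun ρ => ρ a = a) = PS (A.erase a) := by
  ext ρ
  simp only [Finset.mem_filter, mem_PS, Finset.mem_erase, not_and]
  constructor
  · rintro ⟨h1, h2⟩ x hx
    by_cases h : x = a
    · rw [h, h2]
    · exact h1 x (hx h)
  · intro h
    exact ⟨fun x hx => h x (fun _ => hx), h a (by simp)⟩

lemma PS_star {A : Finset α} {a : α} (ha : a ∈ A) (F : X → ℝ) (x : X) :
    (∑ ρ ∈ PS (A.erase a), Tt (star a (A.erase a).toList) F (ρ • x)) * (A.card : ℝ)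
      = ∑ ρ ∈ PS A, F (ρ • x) := by
  rw [← fib_self, fib_T]
  · have h := star_avg a (A.erase a).toList (by simp [Finset.nodup_toList])
      (fun i => ∑ ρ ∈ (PS A).filter (fun ρ => ρ a = i), F (ρ • x))
    have h3 : (((A.erase a).toList.length : ℕ) : ℝ) + 1 = A.card := by
      rw [Finset.length_toList]
      exact_mod_cast Finset.card_erase_add_one ha
    rw [h3] at h
    rw [h, Finset.sum_map_toList, Finset.add_sum_erase A (fun i => ∑ ρ ∈ (PS A).filter (fun ρ => ρ a = i), F (ρ • x)) ha,
      sum_fib ha (fun ρ => F (ρ • x))]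
  · intro e he
    have := star_mem _ _ e he
    rw [Finset.mem_toList] at this
    exact ⟨this.1 ▸ ha, Finset.mem_of_mem_erase this.2⟩

lemma Tt_one (L : List (α × α × ℝ)) (x : X) : Tt L (fun _ : X => (1:ℝ)) x = 1 := by
  induction L generalizing x with
  | nil => rfl
  | cons e L ih => simp only [Tt, ih]; ring

lemma PS_card {A : Finset α} {a : α} (ha : a ∈ A) :
    ((PS (A.erase a)).card : ℝ) * (A.card : ℝ) = (PS A).card := by
  have := PS_star ha (fun _ : α => (1:ℝ)) a
  simpa [Tt_one] using this

end

section
variable {α : Type*} [DecidableEq α] [Fintype α]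

theorem naive (T : Finset α) : ∀ A : Finset α, T ⊆ A → ∃ L : List (α × α × ℝ),
    (∀ e ∈ L, e.1 ≠ e.2.1 ∧ 0 ≤ e.2.2 ∧ e.2.2 ≤ 1) ∧
    2 * L.length + T.card * (T.card + 1) = 2 * T.card * A.card ∧
    ∀ (t : ℕ) (F : (Fin t → α) → ℝ) (g : Fin t → α), (∀ j, g j ∈ A → g j ∈ T) →
      Tt L F g * (PS A).card = ∑ ρ ∈ PS A, F (ρ • g) := by
  induction T using Finset.induction_on with
  | empty =>
    intro A _
    refine ⟨[], by simp, by simp, ?_⟩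
    intro t F g hg
    have : ∀ ρ ∈ PS A, F (ρ • g) = F g := by
      intro ρ hρ
      congr 1
      funext j
      exact mem_PS.1 hρ _ (fun h => by simpa using hg j h)
    rw [Finset.sum_congr rfl this]
    simp [Tt, mul_comm]
  | insert a T haT ih =>
    intro A hA
    have ha : a ∈ A := hA (by simp)
    obtain ⟨L, h1, h2, h3⟩ := ih (A.erase a) (fun x hx => by
      refine Finset.mem_erase.2 ⟨?_, hA (by simp [hx])⟩
      rintro rfl; exact haT hx)
    refine ⟨L ++ star a (A.erase a).toList, ?_, ?_, ?_⟩
    · intro e he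
      rw [List.mem_append] at he
      rcases he with he | he
      · exact h1 e he
      · exact star_valid _ _ (by simp) e he
    · rw [List.length_append, star_length, Finset.length_toList, Finset.card_insert_of_notMem haT]
      have h4 := Finset.card_erase_add_one ha
      rw [← h4]
      nlinarith
    · intro t F g hg
      rw [Tt_append, ← PS_card ha, ← mul_assoc, h3, PS_star ha]
      intro j hj
      have := hg j (Finset.mem_of_mem_erase hj)
      rw [Finset.mem_insert] at this
      exact this.resolve_left (Finset.ne_of_mem_erase hj)

/-- counting permutations with prescribed values -/
theorem count {ι : Type*} [DecidableEq ι] (A : Finset α) (x y : ι → α) (J : Finset ι)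
    (hx : ∀ j ∈ J, x j ∈ A) (hy : ∀ j ∈ J, y j ∈ A)
    (ix : Set.InjOn x J) (iy : Set.InjOn y J) :
    (((PS A).filter (fun ρ => ∀ j ∈ J, ρ (x j) = y j)).card : ℝ) * (A.card.descFactorial J.card : ℝ)
      = (PS A).card := by
  induction J using Finset.induction_on with
  | empty => simp
  | insert i J hi ih =>
    have ih := ih (fun j hj => hx j (by simp [hj])) (fun j hj => hy j (by simp [hj]))
      (ix.mono (by simp)) (iy.mono (by simp))
    have hxi := hx i (by simp)
    have hyi := hy i (by simp)
    rw [Finset.card_insert_of_notMem hi, Nat.descFactorial_succ, ← ih]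
    have key : ((PS A).filter (fun ρ => ∀ j ∈ J, ρ (x j) = y j)).card =
        (A.card - J.card) * ((PS A).filter (fun ρ => ∀ j ∈ insert i J, ρ (x j) = y j)).card := by
      have hm : ∀ ρ ∈ (PS A).filter (fun ρ => ∀ j ∈ J, ρ (x j) = y j),
          ρ (x i) ∈ A \ J.image y := by
        intro ρ hρ
        rw [Finset.mem_filter] at hρ
        rw [Finset.mem_sdiff]
        refine ⟨PS_apply_mem hρ.1 hxi, ?_⟩
        intro h
        obtain ⟨j, hj, h⟩ := Finset.mem_image.1 h
        rw [← hρ.2 j hj] at h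
        have := ix (by simp [hj]) (by simp) (ρ.injective h)
        exact hi (this ▸ hj)
      rw [Finset.card_eq_sum_card_fiberwise hm]
      have hc : (A \ J.image y).card = A.card - J.card := by
        rw [Finset.card_sdiff_of_subset, Finset.card_image_of_injOn (iy.mono (by simp))]
        intro z hz
        obtain ⟨j, hj, rfl⟩ := Finset.mem_image.1 hz
        exact hy j (by simp [hj])
      rw [← hc, ← smul_eq_mul, ← Finset.sum_const]
      refine Finset.sum_congr rfl ?_
      intro z hz
      rw [Finset.mem_sdiff] at hz
      have hyJ : y i ∉ J.image y := by
        intro h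
        obtain ⟨j, hj, h⟩ := Finset.mem_image.1 h
        have := iy (by simp [hj]) (by simp) h
        exact hi (this ▸ hj)
      have hfix : ∀ j ∈ J, swap z (y i) (y j) = y j := by
        intro j hj
        refine swap_apply_of_ne_of_ne ?_ ?_
        · rintro rfl; exact hz.2 (Finset.mem_image_of_mem _ hj)
        · intro h; exact hyJ (h ▸ Finset.mem_image_of_mem _ hj)
      refine Finset.card_bij' (fun ρ _ => swap z (y i) * ρ) (fun ρ _ => swap z (y i) * ρ) ?_ ?_ ?_ ?_
      · intro ρ h
        simp only [Finset.mem_filter, Finset.mem_insert, forall_eq_or_imp] at h ⊢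
        refine ⟨swap_mul_mem_PS hz.1 hyi h.1.1, by simp [h.2], fun j hj => ?_⟩
        rw [Perm.mul_apply, h.1.2 j hj, hfix j hj]
      · intro ρ h
        simp only [Finset.mem_filter, Finset.mem_insert, forall_eq_or_imp] at h ⊢
        refine ⟨⟨swap_mul_mem_PS hz.1 hyi h.1, fun j hj => ?_⟩, by simp [h.2.1]⟩
        rw [Perm.mul_apply, h.2.2 j hj, hfix j hj]
      · intro ρ h; simp
      · intro ρ h; simp
    rw [key]
    push_cast
    ring

end

section
variable {k t : ℕ}

/-- Flip columns according to `ε`. -/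
def fl (ε : Fin k → Fin 2) (g : Fin t → Fin 2 × Fin k) : Fin t → Fin 2 × Fin k :=
  fun j => ((g j).1 + ε (g j).2, (g j).2)

lemma swap_eq_fl (i : Fin k) (g : Fin t → Fin 2 × Fin k) :
    swap ((0 : Fin 2), i) (1, i) • g = fl (Pi.single i 1) g := by
  funext j
  simp only [Pi.smul_apply, Perm.smul_def, fl]
  generalize g j = x
  obtain ⟨s, c⟩ := x
  by_cases h : c = i
  · subst h
    fin_cases s <;> simp
  · rw [swap_apply_of_ne_of_ne] <;> simp [h]

lemma fl_fl (ε δ : Fin k → Fin 2) (g : Fin t → Fin 2 × Fin k) :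
    fl ε (fl δ g) = fl (δ + ε) g := by
  funext j
  simp [fl, add_assoc]

/-- List of column swaps. -/
noncomputable def pairs (l : List (Fin k)) : List ((Fin 2 × Fin k) × (Fin 2 × Fin k) × ℝ) :=
  l.map (fun i => ((0, i), (1, i), 1 / 2))

/-- Restrict `ε` to the columns in `l`. -/
def mask (l : List (Fin k)) (ε : Fin k → Fin 2) : Fin k → Fin 2 :=
  fun i => if i ∈ l then ε i else 0

lemma pairs_T (l : List (Fin k)) (hl : l.Nodup) (F : (Fin t → Fin 2 × Fin k) → ℝ)
    (g : Fin t → Fin 2 × Fin k) :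
    Tt (pairs l) F g * 2 ^ k = ∑ ε : Fin k → Fin 2, F (fl (mask l ε) g) := by
  induction l generalizing g with
  | nil =>
    have : ∀ ε : Fin k → Fin 2, fl (mask [] ε) g = g := by
      intro ε; funext j; simp [fl, mask]
    simp [pairs, Tt, this, mul_comm]
  | cons i l ih =>
    rw [List.nodup_cons] at hl
    have ih := ih hl.2
    have h1 : Tt (pairs (i :: l)) F g =
        1/2 * Tt (pairs l) F (fl (Pi.single i 1) g) + (1 - 1/2) * Tt (pairs l) F g := by
      rw [← swap_eq_fl]; rfl
    have h2 : ∑ ε : Fin k → Fin 2, F (fl (mask (i :: l) ε) g) =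
        ∑ ε : Fin k → Fin 2, F (fl (mask (i :: l) (ε + Pi.single i 1)) g) :=
      (Equiv.sum_comp (Equiv.addRight (Pi.single i 1 : Fin k → Fin 2))
        (fun ε => F (fl (mask (i :: l) ε) g))).symm
    have h3 : ∀ ε : Fin k → Fin 2, F (fl (mask (i :: l) ε) g) +
        F (fl (mask (i :: l) (ε + Pi.single i 1)) g) =
        F (fl (mask l ε) (fl (Pi.single i 1) g)) + F (fl (mask l ε) g) := by
      intro ε
      rw [fl_fl]
      have h : ε i = 0 ∨ ε i = 1 := by omega
      rcases h with h | h
      · have e1 : mask (i :: l) ε = mask l ε := by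
          funext c
          by_cases hc : c = i
          · subst hc; simp [mask, h]
          · simp [mask, hc]
        have e2 : mask (i :: l) (ε + Pi.single i 1) = Pi.single i 1 + mask l ε := by
          funext c
          by_cases hc : c = i
          · subst hc; simp [mask, h, hl.1]
          · simp [mask, hc]
        rw [e1, e2, add_comm]
      · have e1 : mask (i :: l) ε = Pi.single i 1 + mask l ε := by
          funext c
          by_cases hc : c = i
          · subst hc; simp [mask, h, hl.1]
          · simp [mask, hc]
        have e2 : mask (i :: l) (ε + Pi.single i 1) = mask l ε := by
          funext c
          by_cases hc : c = i
          · subst hc; simp [mask, h, hl.1]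
          · simp [mask, hc]
        rw [e1, e2]
    have h4 := Finset.sum_congr (rfl : (Finset.univ : Finset (Fin k → Fin 2)) = _) (fun ε _ => h3 ε)
    rw [Finset.sum_add_distrib, Finset.sum_add_distrib, ← h2, ← ih, ← ih] at h4
    rw [h1]
    linarith

/-- Indicator. -/
noncomputable def dl (f : Fin t → Fin 2 × Fin k) : (Fin t → Fin 2 × Fin k) → ℝ :=
  fun g => if g = f then 1 else 0

lemma flips_count (C : Finset (Fin k)) (v : Fin k → Fin 2) :
    ((Finset.univ.filter (fun ε : Fin k → Fin 2 => ∀ i ∈ C, ε i = v i)).card : ℝ) * 2 ^ C.card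
      = 2 ^ k := by
  have : Finset.univ.filter (fun ε : Fin k → Fin 2 => ∀ i ∈ C, ε i = v i) =
      Fintype.piFinset (fun i => if i ∈ C then {v i} else Finset.univ) := by
    ext ε
    simp only [Finset.mem_filter, Finset.mem_univ, true_and, Fintype.mem_piFinset]
    refine forall_congr' fun i => ?_
    by_cases h : i ∈ C <;> simp [h]
  rw [this, Fintype.card_piFinset]
  have h2 : ∀ i : Fin k, (if i ∈ C then {v i} else (Finset.univ : Finset (Fin 2))).card =
      if i ∈ C then 1 else 2 := by
    intro i
    split_ifs <;> simp
  simp only [h2]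
  rw [Finset.prod_ite]
  simp only [Finset.prod_const, one_pow, one_mul]
  have h3 : (Finset.univ.filter (fun i => i ∉ C)).card + C.card = k := by
    have := Finset.card_compl_add_card C
    rw [Fintype.card_fin] at this
    refine Eq.trans ?_ this
    congr 2
    ext i; simp
  push_cast
  rw [← pow_add, h3]

lemma pairs_dl (f g : Fin t → Fin 2 × Fin k) (hf : f.Injective) (hg : g.Injective) :
    Tt (pairs (List.finRange k)) (dl f) g =
      if ∀ j, (g j).2 = (f j).2 then
        (1 / 2 : ℝ) ^ (Finset.univ.image (fun j => (f j).2)).card else 0 := by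
  have h := pairs_T (List.finRange k) (List.nodup_finRange k) (dl f) g
  have hm : ∀ ε : Fin k → Fin 2, mask (List.finRange k) ε = ε := by
    intro ε; funext i; simp [mask]
  simp only [hm] at h
  have hp : (2:ℝ) ^ k ≠ 0 := by positivity
  split_ifs with hc
  · set C := Finset.univ.image (fun j => (f j).2) with hC
    have hw : ∀ i : Fin k, ∃ w : Fin 2, ∀ j, (f j).2 = i → (g j).1 + w = (f j).1 := by
      intro i
      by_cases hi : ∃ j, (f j).2 = i
      · obtain ⟨j, hj⟩ := hi
        refine ⟨(f j).1 - (g j).1, ?_⟩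
        intro l hl
        by_cases hjl : j = l
        · subst hjl; simp
        · have a1 : (f j).1 ≠ (f l).1 := fun h => hjl (hf (Prod.ext h (hj.trans hl.symm)))
          have a2 : (g j).1 ≠ (g l).1 := fun h =>
            hjl (hg (Prod.ext h (by rw [hc, hc, hj, hl])))
          generalize (f j).1 = p at *
          generalize (f l).1 = q at *
          generalize (g j).1 = r at *
          generalize (g l).1 = s at *
          revert a1 a2
          revert p q r s
          decide
      · exact ⟨0, fun j hj => (hi ⟨j, hj⟩).elim⟩
    choose v hv using hw
    have hcond : ∀ ε : Fin k → Fin 2, dl f (fl ε g) =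
        if (∀ i ∈ C, ε i = v i) then 1 else 0 := by
      intro ε
      unfold dl
      refine if_congr ?_ rfl rfl
      rw [hC]
      simp only [Finset.mem_image, Finset.mem_univ, true_and, forall_exists_index,
        forall_apply_eq_imp_iff]
      rw [funext_iff]
      refine forall_congr' fun j => ?_
      simp only [fl, Prod.ext_iff, hc, and_true]
      have := hv _ j rfl
      constructor
      · intro h; rw [← this] at h; exact add_left_cancel h
      · intro h; rw [h, this]
    simp only [hcond] at h
    rw [Finset.sum_boole] at h
    have h5 := flips_count C v
    rw [← h5] at h hp
    have hq : (2:ℝ) ^ C.card ≠ 0 := by positivity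
    have hn := left_ne_zero_of_mul hp
    rw [one_div, inv_pow]
    field_simp
    have : Tt (pairs (List.finRange k)) (dl f) g * 2 ^ C.card *
      ((Finset.univ.filter (fun ε : Fin k → Fin 2 => ∀ i ∈ C, ε i = v i)).card : ℝ) =
      1 * ((Finset.univ.filter (fun ε : Fin k → Fin 2 => ∀ i ∈ C, ε i = v i)).card : ℝ) := by
      rw [one_mul]; nth_rw 2 [← h]; ring
    exact mul_right_cancel₀ hn this
  · have hz : ∀ ε : Fin k → Fin 2, dl f (fl ε g) = 0 := by
      intro ε
      unfold dl
      rw [if_neg]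
      rintro rfl
      exact hc (fun j => rfl)
    simp only [hz, Finset.sum_const_zero] at h
    exact (mul_eq_zero.1 h).resolve_right hp

/-- A row of positions. -/
def row (k : ℕ) (r : Fin 2) : Finset (Fin 2 × Fin k) := Finset.univ.filter (fun x => x.1 = r)

lemma mem_row {r : Fin 2} {x : Fin 2 × Fin k} : x ∈ row k r ↔ x.1 = r := by simp [row]

lemma row_card (r : Fin 2) : (row k r).card = k := by
  have : row k r = Finset.univ.image (fun i : Fin k => (r, i)) := by
    ext ⟨a, b⟩
    simp [mem_row, eq_comm]
  rw [this, Finset.card_image_of_injective _ (fun a b h => by simpa using h)]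
  simp

open Classical in
/-- The tail probability. -/
noncomputable def Kv (c : Fin t → Fin k) (J : Finset (Fin t)) : ℝ :=
  if Set.InjOn c (J : Set (Fin t)) ∧ Set.InjOn c ((Jᶜ : Finset (Fin t)) : Set (Fin t)) then
    (1 / 2 : ℝ) ^ (Finset.univ.image c).card /
      ((k.descFactorial J.card : ℝ) * (k.descFactorial Jᶜ.card : ℝ)) else 0

lemma rowN (r : Fin 2) (g : Fin t → Fin 2 × Fin k) (c : Fin t → Fin k) (hg : g.Injective)
    (J : Finset (Fin t)) (hJ : ∀ j ∈ J, (g j).1 = r) (hc : Set.InjOn c J) :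
    (((PS (row k r)).filter (fun ρ => ∀ j ∈ J, ρ (g j) = (r, c j))).card : ℝ) *
      (k.descFactorial J.card : ℝ) = (PS (row k r)).card := by
  have := count (row k r) g (fun j => (r, c j)) J (fun j hj => mem_row.2 (hJ j hj))
    (fun j hj => mem_row.2 rfl) hg.injOn (fun a ha b hb h => hc ha hb (by simpa using h))
  rw [row_card] at this
  convert this

lemma rowN_zero (r : Fin 2) (g : Fin t → Fin 2 × Fin k) (c : Fin t → Fin k) (hg : g.Injective)
    (J : Finset (Fin t)) (hc : ¬ Set.InjOn c J) :
    ((PS (row k r)).filter (fun ρ => ∀ j ∈ J, ρ (g j) = (r, c j))) = ∅ := by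
  rw [Finset.eq_empty_iff_forall_notMem]
  intro ρ hρ
  rw [Finset.mem_filter] at hρ
  refine hc (fun a ha b hb h => ?_)
  have h1 := hρ.2 a ha
  have h2 := hρ.2 b hb
  rw [h, ← h2] at h1
  exact hg (ρ.injective h1)

theorem tail (T B : Finset (Fin 2 × Fin k)) (hT : T ⊆ row k 0) (hB : B ⊆ row k 1) :
    ∃ L : List ((Fin 2 × Fin k) × (Fin 2 × Fin k) × ℝ),
    (∀ e ∈ L, e.1 ≠ e.2.1 ∧ 0 ≤ e.2.2 ∧ e.2.2 ≤ 1) ∧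
    2 * L.length + T.card * (T.card + 1) + B.card * (B.card + 1) =
      2 * T.card * k + 2 * B.card * k + 2 * k ∧
    ∀ (t : ℕ) (f g : Fin t → Fin 2 × Fin k), f.Injective → g.Injective →
      (∀ j, g j ∈ T ∪ B) →
      Tt L (dl f) g = Kv (fun j => (f j).2) (Finset.univ.filter (fun j => (g j).1 = 1)) := by
  obtain ⟨L0, v0, l0, h0⟩ := naive T (row k 0) hT
  obtain ⟨L1, v1, l1, h1⟩ := naive B (row k 1) hB
  rw [row_card] at l0 l1
  refine ⟨L0 ++ (L1 ++ pairs (List.finRange k)), ?_, ?_, ?_⟩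
  · intro e he
    simp only [List.mem_append] at he
    rcases he with he | he | he
    · exact v0 e he
    · exact v1 e he
    · simp only [pairs, List.mem_map] at he
      obtain ⟨i, _, rfl⟩ := he
      norm_num
  · simp only [List.length_append, pairs, List.length_map, List.length_finRange]
    linarith
  · intro t f g hf hg hgTB
    have hrow0 : ∀ j, g j ∈ row k 0 → g j ∈ T := by
      intro j hj
      rcases Finset.mem_union.1 (hgTB j) with h | h
      · exact h
      · have := mem_row.1 (hB h); rw [mem_row.1 hj] at this; exact absurd this (by decide)
    have hrow1 : ∀ j, g j ∈ row k 1 → g j ∈ B := by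
      intro j hj
      rcases Finset.mem_union.1 (hgTB j) with h | h
      · have := mem_row.1 (hT h); rw [mem_row.1 hj] at this; exact absurd this (by decide)
      · exact h
    rw [Tt_append]
    set J := Finset.univ.filter (fun j => (g j).1 = 1) with hJ
    set c := (fun j => (f j).2) with hc
    have memJ : ∀ j, j ∈ J ↔ (g j).1 = 1 := by intro j; simp [hJ]
    have memJ' : ∀ j, j ∈ Jᶜ ↔ (g j).1 = 0 := by
      intro j; rw [Finset.mem_compl, memJ]; omega
    set N0 := ((PS (row k 0)).filter (fun ρ => ∀ j ∈ Jᶜ, ρ (g j) = ((0 : Fin 2), c j)))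
    set N1 := ((PS (row k 1)).filter (fun ρ => ∀ j ∈ J, ρ (g j) = ((1 : Fin 2), c j)))
    set w := (1 / 2 : ℝ) ^ (Finset.univ.image c).card
    have p0 := PS_card_pos (row k 0)
    have p1 := PS_card_pos (row k 1)
    have key : Tt L0 (Tt (L1 ++ pairs (List.finRange k)) (dl f)) g * (PS (row k 0)).card *
        (PS (row k 1)).card = w * N0.card * N1.card := by
      rw [h0 _ _ _ hrow0, Finset.sum_mul]
      have e1 : ∀ ρ ∈ PS (row k 0), Tt (L1 ++ pairs (List.finRange k)) (dl f) (ρ • g) *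
          ((PS (row k 1)).card : ℝ) =
          ∑ τ ∈ PS (row k 1), w * ((if ∀ j ∈ Jᶜ, ρ (g j) = ((0 : Fin 2), c j) then 1 else 0) *
            (if ∀ j ∈ J, τ (g j) = ((1 : Fin 2), c j) then 1 else 0)) := by
        intro ρ hρ
        have fix0 : ∀ j, (g j).1 = 1 → ρ (g j) = g j := by
          intro j hj
          exact mem_PS.1 hρ _ (by rw [mem_row, hj]; decide)
        have stay0 : ∀ j, (g j).1 = 0 → (ρ (g j)).1 = 0 := by
          intro j hj
          exact mem_row.1 (PS_apply_mem hρ (mem_row.2 hj))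
        rw [Tt_append, h1]
        · refine Finset.sum_congr rfl ?_
          intro τ hτ
          have fix1 : ∀ j, (g j).1 = 0 → τ (ρ (g j)) = ρ (g j) := by
            intro j hj
            exact mem_PS.1 hτ _ (by rw [mem_row, stay0 j hj]; decide)
          have stay1 : ∀ j, (g j).1 = 1 → (τ (g j)).1 = 1 := by
            intro j hj
            exact mem_row.1 (PS_apply_mem hτ (mem_row.2 hj))
          rw [pairs_dl f _ hf]
          · have hiff : (∀ j, ((τ • ρ • g) j).2 = (f j).2) ↔
                (∀ j ∈ Jᶜ, ρ (g j) = ((0 : Fin 2), c j)) ∧ (∀ j ∈ J, τ (g j) = ((1 : Fin 2), c j)) := by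
              simp only [memJ, memJ', Pi.smul_apply, Perm.smul_def]
              constructor
              · intro h
                refine ⟨fun j hj => Prod.ext (stay0 j hj) ?_, fun j hj => Prod.ext (stay1 j hj) ?_⟩
                · have := h j; rwa [fix1 j hj] at this
                · have := h j; rwa [fix0 j hj] at this
              · rintro ⟨a, b⟩ j
                have hh : (g j).1 = 0 ∨ (g j).1 = 1 := by omega
                rcases hh with hj | hj
                · rw [fix1 j hj, a j hj]
                · rw [fix0 j hj, b j hj]
            rw [if_congr hiff rfl rfl]
            by_cases a : (∀ j ∈ Jᶜ, ρ (g j) = ((0 : Fin 2), c j)) <;>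
            by_cases b : (∀ j ∈ J, τ (g j) = ((1 : Fin 2), c j))
            · rw [if_pos ⟨a, b⟩, if_pos a, if_pos b]; simp [w, c]
            · rw [if_neg (fun h => b h.2), if_neg b]; simp
            · rw [if_neg (fun h => a h.1), if_neg a]; simp
            · rw [if_neg (fun h => a h.1), if_neg a]; simp
          · intro a b h
            exact hg (ρ.injective (τ.injective h))
        · intro j hj
          simp only [Pi.smul_apply, Perm.smul_def] at hj ⊢
          have hh : (g j).1 = 0 ∨ (g j).1 = 1 := by omega
          rcases hh with hj' | hj'
          · have := stay0 j hj'
            rw [mem_row.1 hj] at this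
            exact absurd this (by decide)
          · rw [fix0 j hj'] at hj ⊢
            exact hrow1 j hj
      rw [Finset.sum_congr rfl e1]
      simp only [← Finset.mul_sum, ← Finset.sum_mul, Finset.sum_boole]
      simp only [N0, N1]
      ring
    unfold Kv
    split_ifs with hinj
    · have a1 := rowN 1 g c hg J (fun j hj => (memJ j).1 hj) hinj.1
      have a0 := rowN 0 g c hg Jᶜ (fun j hj => (memJ' j).1 hj) hinj.2
      change (N1.card : ℝ) * _ = _ at a1
      change (N0.card : ℝ) * _ = _ at a0
      rw [← a0, ← a1] at key
      rw [← a0] at p0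
      rw [← a1] at p1
      have b0 := left_ne_zero_of_mul p0.ne'
      have b1 := left_ne_zero_of_mul p1.ne'
      have d0 := right_ne_zero_of_mul p0.ne'
      have d1 := right_ne_zero_of_mul p1.ne'
      rw [eq_div_iff (mul_ne_zero d1 d0)]
      apply mul_right_cancel₀ (mul_ne_zero b0 b1)
      linear_combination key
    · have hz : (N0.card : ℝ) * N1.card = 0 := by
        rw [not_and_or] at hinj
        rcases hinj with h | h
        · have := rowN_zero 1 g c hg J h
          change N1 = ∅ at this
          simp [this]
        · have := rowN_zero 0 g c hg Jᶜ h
          change N0 = ∅ at this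
          simp [this]
      rw [mul_assoc w, hz, mul_zero, mul_assoc] at key
      exact (mul_eq_zero.1 key).resolve_right (mul_pos p0 p1).ne'

end

section
variable {n t k : ℕ}

lemma placeSum (L : List (LazyT n)) (f g : Fin t → Fin n) :
    (∑ σ : Perm (Fin n), if ∀ i, σ (g i) = f i then permDist L σ else 0) =
      Tt L (fun h => if h = f then (1:ℝ) else 0) g := by
  induction L generalizing g with
  | nil =>
    simp only [permDist, Tt]
    rw [Finset.sum_eq_single 1]
    · simp [funext_iff]
    · intro σ _ h; simp [h]
    · simp
  | cons e L ih =>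
    simp only [Tt]
    rw [← ih, ← ih, Finset.mul_sum, Finset.mul_sum,
      ← Equiv.sum_comp (Equiv.mulRight (swap e.1 e.2.1))
        (fun σ => e.2.2 * if ∀ i, σ ((swap e.1 e.2.1 • g) i) = f i then permDist L σ else 0),
      ← Finset.sum_add_distrib]
    refine Finset.sum_congr rfl fun σ _ => ?_
    simp only [Equiv.coe_mulRight, Pi.smul_apply, Perm.smul_def, Perm.mul_apply, swap_apply_self]
    split_ifs <;> simp [permDist]

lemma Tt_map {α β : Type*} [DecidableEq α] [DecidableEq β] (e : α ≃ β) (L : List (α × α × ℝ))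
    (F : (Fin t → β) → ℝ) (g : Fin t → α) :
    Tt (L.map (fun x => (e x.1, e x.2.1, x.2.2))) F (fun j => e (g j)) =
      Tt L (fun h => F (fun j => e (h j))) g := by
  induction L generalizing g with
  | nil => rfl
  | cons x L ih =>
    simp only [List.map_cons, Tt]
    rw [ih, ← ih (swap x.1 x.2.1 • g)]
    congr 3
    funext j
    simp only [Pi.smul_apply, Perm.smul_def]
    generalize g j = y
    simp only [swap_apply_def, e.injective.eq_iff]
    split_ifs <;> rfl

/-- Starting placement. -/
def st (ht : t ≤ k) : Fin t → Fin 2 × Fin k := fun j => (0, Fin.castLE ht j)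

theorem bridge (ht : t ≤ k) (L : List ((Fin 2 × Fin k) × (Fin 2 × Fin k) × ℝ))
    (hv : ∀ e ∈ L, e.1 ≠ e.2.1 ∧ 0 ≤ e.2.2 ∧ e.2.2 ≤ 1)
    (h : ∀ f : Fin t → Fin 2 × Fin k, f.Injective →
      Tt L (dl f) (st ht) = ((2 * k - t).factorial : ℝ) / ((2 * k).factorial : ℝ)) :
    Ut t (2 * k) ≤ L.length := by
  let e : Fin 2 × Fin k ≃ Fin (2 * k) := finProdFinEquiv
  refine Nat.sInf_le ⟨by omega, L.map (fun x => (e x.1, e x.2.1, x.2.2)), by simp, ?_, ?_⟩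
  · intro x hx
    obtain ⟨y, hy, rfl⟩ := List.mem_map.1 hx
    have := hv y hy
    exact ⟨fun h => this.1 (e.injective h), this.2⟩
  · intro f hf
    unfold placeProb
    have hs : ∀ i : Fin t, Fin.castLE (by omega : t ≤ 2 * k) i = e (st ht i) := by
      intro i
      apply Fin.ext
      simp [e, st, finProdFinEquiv]
    simp only [hs]
    rw [placeSum _ f (fun i => e (st ht i)), Tt_map, ← h (fun j => e.symm (f j))
      (fun a b hab => hf (e.symm.injective hab))]
    congr 1
    funext g
    unfold dl
    refine if_congr ?_ rfl rfl
    rw [funext_iff, funext_iff]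
    exact forall_congr' fun j => by rw [Equiv.eq_symm_apply]

lemma st_inj (ht : t ≤ k) : (st ht).Injective := by
  intro a b h
  simpa [st] using h

/-- The set of starting positions. -/
def T0 (ht : t ≤ k) : Finset (Fin 2 × Fin k) := Finset.univ.image (st ht)

lemma T0_card (ht : t ≤ k) : (T0 ht).card = t := by
  rw [T0, Finset.card_image_of_injective _ (st_inj ht)]; simp

lemma T0_row (ht : t ≤ k) : T0 ht ⊆ row k 0 := by
  intro x hx
  obtain ⟨j, _, rfl⟩ := Finset.mem_image.1 hx
  simp [mem_row, st]

theorem head (ht : t ≤ k) (u v : Fin t) (huv : u ≠ v) :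
    ∃ L : List ((Fin 2 × Fin k) × (Fin 2 × Fin k) × ℝ),
    (∀ e ∈ L, e.1 ≠ e.2.1 ∧ 0 ≤ e.2.2 ∧ e.2.2 ≤ 1) ∧
    2 * L.length + t * (t + 1) = 2 * t * t ∧
    ∀ (F : (Fin t → Fin 2 × Fin k) → ℝ) (Φ : Fin t → Fin t → ℝ),
      (∀ g : Fin t → Fin 2 × Fin k, g.Injective → (∀ j, g j ∈ T0 ht) → ∀ i j, g i = st ht u →
        g j = st ht v → F g = Φ i j) →
      Tt L F (st ht) * (t.descFactorial 2 : ℝ) = ∑ i, ∑ j, if i = j then 0 else Φ i j := by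
  obtain ⟨L, hv, hl, h⟩ := naive (T0 ht) (T0 ht) (le_refl _)
  rw [T0_card] at hl
  refine ⟨L, hv, hl, ?_⟩
  intro F Φ hF
  have hs : ∀ j, st ht j ∈ T0 ht := fun j => Finset.mem_image_of_mem _ (Finset.mem_univ j)
  have h1 := h t F (st ht) (fun j _ => hs j)
  have h2 : ∀ ρ ∈ PS (T0 ht), F (ρ • st ht) =
      ∑ i, ∑ j, if (ρ (st ht i) = st ht u ∧ ρ (st ht j) = st ht v) then Φ i j else 0 := by
    intro ρ hρ
    have hinj : (ρ • st ht).Injective := fun a b hab => st_inj ht (ρ.injective hab)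
    have hmem : ∀ j, (ρ • st ht) j ∈ T0 ht := fun j => PS_apply_mem hρ (hs j)
    have hsurj : ∀ w, ∃ i, ρ (st ht i) = st ht w := by
      have himg : Finset.univ.image (ρ • st ht) = T0 ht := by
        apply Finset.eq_of_subset_of_card_le
        · intro x hx
          obtain ⟨j, _, rfl⟩ := Finset.mem_image.1 hx
          exact hmem j
        · rw [Finset.card_image_of_injective _ hinj, T0_card]; simp
      intro w
      have := hs w
      rw [← himg] at this
      obtain ⟨j, _, hj⟩ := Finset.mem_image.1 this
      exact ⟨j, hj⟩
    obtain ⟨i, hi⟩ := hsurj u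
    obtain ⟨j, hj⟩ := hsurj v
    rw [hF (ρ • st ht) hinj hmem i j hi hj, Finset.sum_eq_single i, Finset.sum_eq_single j]
    · rw [if_pos ⟨hi, hj⟩]
    · intro b _ hb
      rw [if_neg]
      rintro ⟨_, h⟩
      exact hb (st_inj ht (ρ.injective (h.trans hj.symm)))
    · simp
    · intro b _ hb
      refine Finset.sum_eq_zero fun c _ => ?_
      rw [if_neg]
      rintro ⟨h, _⟩
      exact hb (st_inj ht (ρ.injective (h.trans hi.symm)))
    · simp
  rw [Finset.sum_congr rfl h2, Finset.sum_comm] at h1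
  have h3 : ∀ i j : Fin t, (∑ ρ ∈ PS (T0 ht),
      if (ρ (st ht i) = st ht u ∧ ρ (st ht j) = st ht v) then Φ i j else 0) *
        (t.descFactorial 2 : ℝ) = (if i = j then 0 else Φ i j) * (PS (T0 ht)).card := by
    intro i j
    by_cases hij : i = j
    · rw [if_pos hij, zero_mul, Finset.sum_eq_zero, zero_mul]
      intro ρ _
      rw [if_neg]
      rintro ⟨a, b⟩
      subst hij
      exact huv (st_inj ht (a.symm.trans b))
    · rw [if_neg hij, ← Finset.sum_filter, Finset.sum_const, nsmul_eq_mul]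
      have := count (T0 ht) ![st ht i, st ht j] ![st ht u, st ht v] Finset.univ
        (by simp [Fin.forall_fin_two, hs]) (by simp [Fin.forall_fin_two, hs])
        (by
          intro a _ b _
          have : st ht i ≠ st ht j := fun h => hij (st_inj ht h)
          have h' := this.symm
          fin_cases a <;> fin_cases b <;> simp [this, h'])
        (by
          intro a _ b _
          have : st ht u ≠ st ht v := fun h => huv (st_inj ht h)
          have h' := this.symm
          fin_cases a <;> fin_cases b <;> simp [this, h'])
      rw [T0_card] at this
      simp only [Finset.mem_univ, forall_true_left, Fin.forall_fin_two, Matrix.cons_val_zero,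
        Matrix.cons_val_one, Finset.card_univ, Fintype.card_fin] at this
      rw [← this]
      ring
  have h4 : Tt L F (st ht) * (PS (T0 ht)).card * (t.descFactorial 2 : ℝ) =
      (∑ i, ∑ j, if i = j then 0 else Φ i j) * (PS (T0 ht)).card := by
    rw [h1]
    simp only [Finset.sum_mul]
    refine Finset.sum_congr rfl fun i _ => ?_
    rw [Finset.sum_comm]
    refine Finset.sum_congr rfl fun j _ => ?_
    rw [← Finset.sum_mul]
    exact h3 i j
  have hp := (PS_card_pos (T0 ht)).ne'
  apply mul_right_cancel₀ hp
  linear_combination h4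

lemma swap_update {α : Type*} [DecidableEq α] (g : Fin t → α) (hg : g.Injective) (i : Fin t) (P Q : α) (hi : g i = P)
    (hQ : ∀ l, g l ≠ Q) : swap P Q • g = Function.update g i Q := by
  funext l
  simp only [Pi.smul_apply, Perm.smul_def]
  by_cases h : l = i
  · subst h; simp [hi]
  · rw [Function.update_of_ne h, swap_apply_of_ne_of_ne _ (hQ l)]
    intro h'
    exact h (hg (h'.trans hi.symm))

lemma smul_inj {α : Type*} [DecidableEq α] (ρ : Perm α) (g : Fin t → α) (hg : g.Injective) :
    (ρ • g).Injective := fun _ _ hab => hg (ρ.injective hab)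

end

section
variable {k : ℕ}

lemma three_cols {t : ℕ} (f : Fin t → Fin 2 × Fin k) (hf : f.Injective) (a b c : Fin t)
    (hab : a ≠ b) (hac : a ≠ c) (hbc : b ≠ c) (h1 : (f a).2 = (f b).2) (h2 : (f a).2 = (f c).2) :
    False := by
  have e1 : (f a).1 ≠ (f b).1 := fun h => hab (hf (Prod.ext h h1))
  have e2 : (f a).1 ≠ (f c).1 := fun h => hac (hf (Prod.ext h h2))
  have e3 : (f b).1 ≠ (f c).1 := fun h => hbc (hf (Prod.ext h (h1.symm.trans h2)))
  omega

lemma inj_cond {t : ℕ} (c : Fin t → Fin k) (J : Finset (Fin t)) :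
    (Set.InjOn c (J : Set (Fin t)) ∧ Set.InjOn c ((Jᶜ : Finset (Fin t)) : Set (Fin t))) ↔
      ∀ x y, x < y → c x = c y → (x ∈ J ↔ y ∉ J) := by
  constructor
  · rintro ⟨h1, h2⟩ x y hxy hc
    constructor
    · intro hx hy; exact hxy.ne (h1 hx hy hc)
    · intro hy
      by_contra hx
      exact hxy.ne (h2 (by simpa using hx) (by simpa using hy) hc)
  · intro h
    constructor
    · intro x hx y hy hc
      rcases lt_trichotomy x y with hl | hl | hl
      · exact absurd hy ((h x y hl hc).1 hx)
      · exact hl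
      · exact absurd hx ((h y x hl hc.symm).1 hy)
    · intro x hx y hy hc
      simp only [Finset.coe_compl, Set.mem_compl_iff, Finset.mem_coe] at hx hy
      rcases lt_trichotomy x y with hl | hl | hl
      · exact absurd ((h x y hl hc).2 hy) hx
      · exact hl
      · exact absurd ((h y x hl hc.symm).2 hx) hy

lemma Kv3 (c : Fin 3 → Fin k) (J : Finset (Fin 3)) :
    Kv c J = if (c 0 = c 1 → (0 ∈ J ↔ 1 ∉ J)) ∧ (c 0 = c 2 → (0 ∈ J ↔ 2 ∉ J)) ∧
      (c 1 = c 2 → (1 ∈ J ↔ 2 ∉ J)) then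
      (1 / 2 : ℝ) ^ (Finset.univ.image c).card /
      ((k.descFactorial J.card : ℝ) * (k.descFactorial (3 - J.card) : ℝ)) else 0 := by
  unfold Kv
  rw [Finset.card_compl, Fintype.card_fin]
  refine if_congr ?_ rfl rfl
  rw [inj_cond]
  simp [Fin.forall_fin_succ]
  try tauto

lemma Kv4 (c : Fin 4 → Fin k) (J : Finset (Fin 4)) :
    Kv c J = if (c 0 = c 1 → (0 ∈ J ↔ 1 ∉ J)) ∧ (c 0 = c 2 → (0 ∈ J ↔ 2 ∉ J)) ∧
      (c 0 = c 3 → (0 ∈ J ↔ 3 ∉ J)) ∧ (c 1 = c 2 → (1 ∈ J ↔ 2 ∉ J)) ∧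
      (c 1 = c 3 → (1 ∈ J ↔ 3 ∉ J)) ∧ (c 2 = c 3 → (2 ∈ J ↔ 3 ∉ J)) then
      (1 / 2 : ℝ) ^ (Finset.univ.image c).card /
      ((k.descFactorial J.card : ℝ) * (k.descFactorial (4 - J.card) : ℝ)) else 0 := by
  unfold Kv
  rw [Finset.card_compl, Fintype.card_fin]
  refine if_congr ?_ rfl rfl
  rw [inj_cond]
  simp [Fin.forall_fin_succ]
  try tauto

lemma image3 (c : Fin 3 → Fin k) : Finset.univ.image c = {c 0, c 1, c 2} := by
  ext x; simp [Fin.exists_fin_succ, eq_comm]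

lemma image4 (c : Fin 4 → Fin k) : Finset.univ.image c = {c 0, c 1, c 2, c 3} := by
  ext x; simp [Fin.exists_fin_succ, eq_comm]

end

section
variable {k : ℕ}

lemma df2 (n : ℕ) (h : 2 ≤ n) : ((n.descFactorial 2 : ℕ) : ℝ) = n * (n - 1) := by
  rw [Nat.descFactorial_succ, Nat.descFactorial_one]
  rw [Nat.cast_mul, Nat.cast_sub (by omega)]; push_cast; ring

lemma df3 (n : ℕ) (h : 3 ≤ n) : ((n.descFactorial 3 : ℕ) : ℝ) = n * (n - 1) * (n - 2) := by
  rw [Nat.descFactorial_succ, Nat.cast_mul, df2 n (by omega), Nat.cast_sub (by omega)]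
  push_cast; ring

lemma df4 (n : ℕ) (h : 4 ≤ n) :
    ((n.descFactorial 4 : ℕ) : ℝ) = n * (n - 1) * (n - 2) * (n - 3) := by
  rw [Nat.descFactorial_succ, Nat.cast_mul, df3 n (by omega), Nat.cast_sub (by omega)]
  push_cast; ring

lemma fact_ratio (n t : ℕ) (h : t ≤ n) :
    ((n - t).factorial : ℝ) / (n.factorial : ℝ) = 1 / (n.descFactorial t : ℝ) := by
  have h1 := Nat.factorial_mul_descFactorial h
  have h2 : ((n - t).factorial : ℝ) ≠ 0 := by exact_mod_cast Nat.factorial_ne_zero _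
  rw [← h1]
  push_cast
  rw [div_mul_eq_div_div, div_self h2]

lemma num3 (x p : ℝ) (hx : 3 ≤ x) (hp : p * (2 * (2 * x - 1)) = 3 * x) :
    1 / 8 * ((1 - p) * (1 / (1 * (x * (x - 1) * (x - 2)))) + p * (1 / (x * (x * (x - 1))))) =
      1 / (2 * x * (2 * x - 1) * (2 * x - 2)) ∧
    1 / 4 * (p * (1 / (x * (x * (x - 1)))) * 2 / 3) =
      1 / (2 * x * (2 * x - 1) * (2 * x - 2)) := by
  have hd : (0:ℝ) < 2 * (2 * x - 1) := by linarith
  have n0 : x ≠ 0 := by linarith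
  have n1 : x - 1 ≠ 0 := by linarith
  have n2 : x - 2 ≠ 0 := by linarith
  have n3 : 2 * x - 1 ≠ 0 := by linarith
  have e : 2 * x - 2 = 2 * (x - 1) := by ring
  have hp' : p = 3 * x / (2 * (2 * x - 1)) := by rw [eq_div_iff hd.ne', hp]
  have hq' : 1 - p = (x - 2) / (2 * (2 * x - 1)) := by
    rw [eq_div_iff hd.ne']; linear_combination (-1) * hp
  rw [e]
  constructor
  · rw [hq', hp', ← sub_eq_zero]
    field_simp
    ring
  · rw [hp', ← sub_eq_zero]
    field_simp
    ring

lemma sum3 (c : Fin 3 → Fin k) (κ0 κ1 p r : ℝ)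
    (hκ0 : κ0 = 1 / ((k.descFactorial 0 : ℕ) * (k.descFactorial 3 : ℕ)))
    (hκ1 : κ1 = 1 / ((k.descFactorial 1 : ℕ) * (k.descFactorial 2 : ℕ)))
    (N0 : 1 / 8 * ((1 - p) * κ0 + p * κ1) = r)
    (N1 : 1 / 4 * (p * κ1 * 2 / 3) = r)
    (g0 : c 0 = c 1 → c 0 = c 2 → False) (g1 : c 1 = c 0 → c 1 = c 2 → False)
    (g2 : c 2 = c 0 → c 2 = c 1 → False) :
    (∑ i : Fin 3, ∑ j : Fin 3, if i = j then 0 else p * Kv c {i} + (1 - p) * Kv c ∅) = 6 * r := by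
  obtain ⟨w, hw⟩ : ∃ w : ℝ, w = (1 / 2 : ℝ) ^ (Finset.univ.image c).card := ⟨_, rfl⟩
  have K0 := Kv3 c ∅
  have K1 := fun i => Kv3 c {i}
  simp only [Finset.card_empty, Finset.card_singleton, ← hw, Nat.sub_zero,
    show 3 - 1 = 2 from rfl] at K0 K1
  rw [div_eq_mul_one_div, ← hκ0] at K0
  simp only [div_eq_mul_one_div w, ← hκ1] at K1
  simp only [K0, K1, Fin.sum_univ_three]
  rw [image3] at hw
  clear K0 K1 hκ0 hκ1
  rcases Classical.propComplete (c 0 = c 1) with h01 | h01 <;> rcases Classical.propComplete (c 0 = c 2) with h02 | h02 <;> rcases Classical.propComplete (c 1 = c 2) with h12 | h12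
  any_goals (exfalso; grind)
  all_goals
    first
    | (have hw' : w = 1 / 8 := by
        rw [hw, show ({c 0, c 1, c 2} : Finset (Fin k)).card = 3 by grind]; norm_num
       simp [h01, h02, h12]
       rw [hw']
       linear_combination 6 * N0)
    | (have hw' : w = 1 / 4 := by
        rw [hw, show ({c 0, c 1, c 2} : Finset (Fin k)).card = 2 by grind]; norm_num
       simp [h01, h02, h12]
       rw [hw']
       linear_combination 6 * N1)

lemma num4 (x : ℝ) (hx : 4 ≤ x) : ∃ α β : ℝ, 0 ≤ α ∧ α ≤ 1 ∧ 0 ≤ β ∧ β ≤ 1 ∧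
    1 / 16 * ((1 - α) * (1 - β) * (1 / (1 * (x * (x - 1) * (x - 2) * (x - 3)))) +
      (α + β - 2 * (α * β)) * (1 / (x * (x * (x - 1) * (x - 2)))) +
      α * β * (1 / ((x * (x - 1)) * (x * (x - 1))))) =
      1 / (2 * x * (2 * x - 1) * (2 * x - 2) * (2 * x - 3)) ∧
    1 / 8 * ((α + β - 2 * (α * β)) * (1 / (x * (x * (x - 1) * (x - 2)))) / 2 +
      α * β * (1 / ((x * (x - 1)) * (x * (x - 1)))) * 2 / 3) =
      1 / (2 * x * (2 * x - 1) * (2 * x - 2) * (2 * x - 3)) ∧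
    1 / 4 * (α * β * (1 / ((x * (x - 1)) * (x * (x - 1)))) * 2 / 3) =
      1 / (2 * x * (2 * x - 1) * (2 * x - 2) * (2 * x - 3)) := by
  have n0 : x ≠ 0 := by linarith
  have n1 : x - 1 ≠ 0 := by linarith
  have n2 : x - 2 ≠ 0 := by linarith
  have n3 : x - 3 ≠ 0 := by linarith
  have n4 : 2 * x - 1 ≠ 0 := by linarith
  have n5 : 2 * x - 3 ≠ 0 := by linarith
  have e : 2 * x - 2 = 2 * (x - 1) := by ring
  have hD : 0 < (2 * x - 1) * (2 * x - 3) := mul_pos (by linarith) (by linarith)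
  obtain ⟨s, hs⟩ : ∃ s, s = x * (5 * x - 7) / ((2 * x - 1) * (2 * x - 3)) := ⟨_, rfl⟩
  obtain ⟨q, hq⟩ : ∃ q, q = 3 * x * (x - 1) / (2 * ((2 * x - 1) * (2 * x - 3))) := ⟨_, rfl⟩
  have hdisc : 0 ≤ s ^ 2 - 4 * q := by
    have : s ^ 2 - 4 * q = x * ((x - 2) * (x ^ 2 + 4 * x - 9)) / ((2 * x - 1) * (2 * x - 3)) ^ 2 := by
      rw [hs, hq, ← sub_eq_zero]
      field_simp
      ring
    rw [this]
    apply div_nonneg _ (sq_nonneg _)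
    apply mul_nonneg (by linarith)
    apply mul_nonneg (by linarith)
    nlinarith
  have hs0 : 0 ≤ s := by rw [hs]; exact div_nonneg (mul_nonneg (by linarith) (by linarith)) hD.le
  have hq0 : 0 ≤ q := by
    rw [hq]; exact div_nonneg (mul_nonneg (by linarith) (by linarith)) (by linarith)
  have hs2 : s ≤ 2 := by rw [hs, div_le_iff₀ hD]; nlinarith
  have hs' : s * ((2 * x - 1) * (2 * x - 3)) = x * (5 * x - 7) := by
    rw [hs, div_mul_cancel₀ _ hD.ne']
  have hD2 : 2 * ((2 * x - 1) * (2 * x - 3)) ≠ 0 := by linarith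
  have hq' : q * (2 * ((2 * x - 1) * (2 * x - 3))) = 3 * x * (x - 1) := by
    rw [hq, div_mul_cancel₀ _ hD2]
  have e1 : 1 - s + q = (x - 2) * (x - 3) / (2 * ((2 * x - 1) * (2 * x - 3))) := by
    rw [eq_div_iff hD2]
    linear_combination (-2) * hs' + hq'
  have e2 : s - 2 * q = 2 * x * (x - 2) / ((2 * x - 1) * (2 * x - 3)) := by
    rw [eq_div_iff hD.ne']
    linear_combination hs' - hq'
  have hp0 : 0 ≤ 1 - s + q := by
    rw [e1]
    exact div_nonneg (mul_nonneg (by linarith) (by linarith)) (by linarith)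
  have hr := Real.sq_sqrt hdisc
  have hr0 := Real.sqrt_nonneg (s ^ 2 - 4 * q)
  set d := Real.sqrt (s ^ 2 - 4 * q)
  have hds : d ≤ s := by nlinarith
  have hd2 : d ≤ 2 - s := by nlinarith
  have hab : (s + d) / 2 * ((s - d) / 2) = q := by linarith
  have hab2 : (1 - (s + d) / 2) * (1 - (s - d) / 2) = 1 - s + q := by linarith
  have hab3 : (s + d) / 2 + (s - d) / 2 = s := by ring
  refine ⟨(s + d) / 2, (s - d) / 2, by linarith, by linarith, by linarith, by linarith, ?_⟩
  rw [hab, hab2, hab3, e, e1, e2, hq]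
  refine ⟨?_, ?_, ?_⟩
  · rw [← sub_eq_zero]
    field_simp
    ring
  · rw [← sub_eq_zero]
    field_simp
    ring
  · rw [← sub_eq_zero]
    field_simp
    ring

lemma sum4 (c : Fin 4 → Fin k) (κ0 κ1 κ2 α β r : ℝ)
    (hκ0 : κ0 = 1 / ((k.descFactorial 0 : ℕ) * (k.descFactorial 4 : ℕ)))
    (hκ1 : κ1 = 1 / ((k.descFactorial 1 : ℕ) * (k.descFactorial 3 : ℕ)))
    (hκ2 : κ2 = 1 / ((k.descFactorial 2 : ℕ) * (k.descFactorial 2 : ℕ)))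
    (N0 : 1 / 16 * ((1 - α) * (1 - β) * κ0 + (α + β - 2 * (α * β)) * κ1 + α * β * κ2) = r)
    (N1 : 1 / 8 * ((α + β - 2 * (α * β)) * κ1 / 2 + α * β * κ2 * 2 / 3) = r)
    (N2 : 1 / 4 * (α * β * κ2 * 2 / 3) = r)
    (g0 : ∀ x y z : Fin 4, x ≠ y → x ≠ z → y ≠ z → c x = c y → c x = c z → False) :
    (∑ i : Fin 4, ∑ j : Fin 4, if i = j then 0 else
      α * (β * Kv c {i, j} + (1 - β) * Kv c {i}) + (1 - α) * (β * Kv c {j} + (1 - β) * Kv c ∅))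
      = 12 * r := by
  obtain ⟨w, hw⟩ : ∃ w : ℝ, w = (1 / 2 : ℝ) ^ (Finset.univ.image c).card := ⟨_, rfl⟩
  have K0 := Kv4 c ∅
  have K1 := fun i => Kv4 c {i}
  simp only [Finset.card_empty, Finset.card_singleton, ← hw, Nat.sub_zero,
    show 4 - 1 = 3 from rfl] at K0 K1
  have K2' : ∀ i j : Fin 4, i ≠ j → Kv c {i, j} =
      if (c 0 = c 1 → (0 ∈ ({i, j} : Finset (Fin 4)) ↔ 1 ∉ ({i, j} : Finset (Fin 4)))) ∧
        (c 0 = c 2 → (0 ∈ ({i, j} : Finset (Fin 4)) ↔ 2 ∉ ({i, j} : Finset (Fin 4)))) ∧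
        (c 0 = c 3 → (0 ∈ ({i, j} : Finset (Fin 4)) ↔ 3 ∉ ({i, j} : Finset (Fin 4)))) ∧
        (c 1 = c 2 → (1 ∈ ({i, j} : Finset (Fin 4)) ↔ 2 ∉ ({i, j} : Finset (Fin 4)))) ∧
        (c 1 = c 3 → (1 ∈ ({i, j} : Finset (Fin 4)) ↔ 3 ∉ ({i, j} : Finset (Fin 4)))) ∧
        (c 2 = c 3 → (2 ∈ ({i, j} : Finset (Fin 4)) ↔ 3 ∉ ({i, j} : Finset (Fin 4)))) then
      w * κ2 else 0 := fun i j h => by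
    have := Kv4 c {i, j}
    rw [← hw, Finset.card_pair h, show 4 - 2 = 2 from rfl, div_eq_mul_one_div w, ← hκ2] at this
    exact this
  rw [div_eq_mul_one_div, ← hκ0] at K0
  simp only [div_eq_mul_one_div w, ← hκ1] at K1
  have a01 := g0 0 1 2 (by decide) (by decide) (by decide)
  have a02 := g0 0 1 3 (by decide) (by decide) (by decide)
  have a03 := g0 0 2 3 (by decide) (by decide) (by decide)
  have a12 := g0 1 2 3 (by decide) (by decide) (by decide)
  have E : (∑ i : Fin 4, ∑ j : Fin 4, if i = j then 0 else
      α * (β * Kv c {i, j} + (1 - β) * Kv c {i}) + (1 - α) * (β * Kv c {j} + (1 - β) * Kv c ∅))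
      = 12 * ((1 - α) * (1 - β)) * Kv c ∅ + 3 * (α + β - 2 * (α * β)) *
        (Kv c {0} + Kv c {1} + Kv c {2} + Kv c {3}) + 2 * (α * β) *
        (Kv c {0, 1} + Kv c {0, 2} + Kv c {0, 3} + Kv c {1, 2} + Kv c {1, 3} + Kv c {2, 3}) := by
    have s : ∀ i j : Fin 4, Kv c {j, i} = Kv c {i, j} := fun i j => by rw [Finset.pair_comm]
    simp [Fin.sum_univ_four]
    rw [s 0 1, s 0 2, s 0 3, s 1 2, s 1 3, s 2 3]
    ring
  rw [E, K0, K1, K1, K1, K1, K2' 0 1 (by decide), K2' 0 2 (by decide), K2' 0 3 (by decide),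
    K2' 1 2 (by decide), K2' 1 3 (by decide), K2' 2 3 (by decide)]
  rw [image4] at hw
  clear K0 K1 K2' hκ0 hκ1 hκ2 g0 E
  rcases Classical.propComplete (c 0 = c 1) with h01 | h01 <;> rcases Classical.propComplete (c 0 = c 2) with h02 | h02 <;> rcases Classical.propComplete (c 0 = c 3) with h03 | h03 <;>
    rcases Classical.propComplete (c 1 = c 2) with h12 | h12 <;> rcases Classical.propComplete (c 1 = c 3) with h13 | h13 <;> rcases Classical.propComplete (c 2 = c 3) with h23 | h23
  any_goals (exfalso; clear hw N0 N1 N2; grind)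
  all_goals
    first
    | (have hw' : w = 1 / 16 := by
        rw [hw, show ({c 0, c 1, c 2, c 3} : Finset (Fin k)).card = 4 by clear hw N0 N1 N2; grind]; norm_num
       simp [h01, h02, h03, h12, h13, h23]
       rw [hw']
       linear_combination 12 * N0)
    | (have hw' : w = 1 / 8 := by
        rw [hw, show ({c 0, c 1, c 2, c 3} : Finset (Fin k)).card = 3 by clear hw N0 N1 N2; grind]; norm_num
       simp [h01, h02, h03, h12, h13, h23]
       rw [hw']
       linear_combination 12 * N1)
    | (have hw' : w = 1 / 4 := by
        rw [hw, show ({c 0, c 1, c 2, c 3} : Finset (Fin k)).card = 2 by clear hw N0 N1 N2; grind]; norm_num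
       simp [h01, h02, h03, h12, h13, h23]
       rw [hw']
       linear_combination 12 * N2)

end

section
variable {k : ℕ}

theorem three (hk : 3 ≤ k) : Ut 3 (2 * k) ≤ 5 * k - 3 := by
  obtain ⟨L0, v0, l0, h0⟩ := head hk 0 1 (by decide)
  let Q : Fin 2 × Fin k := (1, ⟨0, by omega⟩)
  obtain ⟨L1, v1, l1, h1⟩ := tail (T0 hk) {Q} (T0_row hk) (by simp [mem_row, Q])
  rw [T0_card, Finset.card_singleton] at l1
  have hkr : (3:ℝ) ≤ k := by exact_mod_cast hk
  let p : ℝ := 3 * k / (2 * (2 * k - 1))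
  have hd : (0:ℝ) < 2 * (2 * k - 1) := by linarith
  have hlen : (L0 ++ (((st hk 0, Q, p) : (Fin 2 × Fin k) × (Fin 2 × Fin k) × ℝ) :: L1)).length
      = 5 * k - 3 := by
    simp only [List.length_append, List.length_cons]
    omega
  rw [← hlen]
  refine bridge hk _ ?_ ?_
  · intro e he
    simp only [List.mem_append, List.mem_cons] at he
    rcases he with he | rfl | he
    · exact v0 e he
    · refine ⟨by simp [st, Q], ?_, ?_⟩
      · exact div_nonneg (by linarith) hd.le
      · exact (div_le_one hd).2 (by linarith)
    · exact v1 e he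
  · intro f hf
    rw [Tt_append]
    set c := (fun j => (f j).2) with hc
    have key := h0 (Tt ((st hk 0, Q, p) :: L1) (dl f))
      (fun i _ => p * Kv c {i} + (1 - p) * Kv c ∅) (by
        intro g hg hgT i j hi hj
        have hr : ∀ l, (g l).1 = 0 := fun l => mem_row.1 (T0_row hk (hgT l))
        have hQ : ∀ l, g l ≠ Q := by
          intro l h
          have := hr l
          rw [h] at this
          simp [Q] at this
        have hu := swap_update g hg i _ Q hi hQ
        have hui := smul_inj (swap (st hk 0) Q) g hg
        simp only [Tt]
        rw [hu] at hui ⊢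
        rw [h1 3 f _ hf hui, h1 3 f g hf hg (fun l => Finset.mem_union_left _ (hgT l))]
        · congr 3
          · ext l
            by_cases hl : l = i <;> simp [Function.update_apply, hl, hr, Q]
          · congr 1
            ext l
            simp [hr]
        · intro l
          by_cases hl : l = i
          · simp [hl]
          · simp [Function.update_of_ne hl, hgT])
    have hdf : ((3:ℕ).descFactorial 2 : ℝ) = 6 := by norm_num [Nat.descFactorial]
    rw [hdf] at key
    have hkr2 : (((2 * k : ℕ)) : ℝ) = 2 * k := by push_cast; ring
    have hp : p * (2 * (2 * (k:ℝ) - 1)) = 3 * k := div_mul_cancel₀ _ hd.ne'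
    obtain ⟨N0, N1⟩ := num3 (k : ℝ) p hkr hp
    have S := sum3 c _ _ p (1 / (2 * k * (2 * k - 1) * (2 * k - 2))) rfl rfl
      (by rw [df3 k hk, df2 k (by omega), Nat.descFactorial_zero, Nat.descFactorial_one,
            Nat.cast_one]; exact N0)
      (by rw [df2 k (by omega), Nat.descFactorial_one]; exact N1)
      (three_cols f hf 0 1 2 (by decide) (by decide) (by decide))
      (three_cols f hf 1 0 2 (by decide) (by decide) (by decide))
      (three_cols f hf 2 0 1 (by decide) (by decide) (by decide))
    rw [fact_ratio (2 * k) 3 (by omega), df3 (2 * k) (by omega), hkr2]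
    linarith [key, S]

theorem four (hk : 4 ≤ k) : Ut 4 (2 * k) ≤ 7 * k - 5 := by
  obtain ⟨L0, v0, l0, h0⟩ := head hk 0 1 (by decide)
  let Q0 : Fin 2 × Fin k := (1, ⟨0, by omega⟩)
  let Q1 : Fin 2 × Fin k := (1, ⟨1, by omega⟩)
  have hQQ : Q0 ≠ Q1 := by simp [Q0, Q1]
  obtain ⟨L1, v1, l1, h1⟩ := tail (T0 hk) {Q0, Q1} (T0_row hk) (by
    intro x hx
    rcases Finset.mem_insert.1 hx with rfl | hx
    · simp [mem_row, Q0]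
    · rw [Finset.mem_singleton.1 hx]; simp [mem_row, Q1])
  rw [T0_card, Finset.card_pair hQQ] at l1
  have hkr : (4:ℝ) ≤ k := by exact_mod_cast hk
  obtain ⟨α, β, a0, a1, b0, b1, N0, N1, N2⟩ := num4 (k : ℝ) hkr
  have hlen : (L0 ++ (((st hk 0, Q0, α) : (Fin 2 × Fin k) × (Fin 2 × Fin k) × ℝ) ::
      (st hk 1, Q1, β) :: L1)).length = 7 * k - 5 := by
    simp only [List.length_append, List.length_cons]
    omega
  rw [← hlen]
  refine bridge hk _ ?_ ?_
  · intro e he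
    simp only [List.mem_append, List.mem_cons] at he
    rcases he with he | rfl | rfl | he
    · exact v0 e he
    · exact ⟨by simp [st, Q0], a0, a1⟩
    · exact ⟨by simp [st, Q1], b0, b1⟩
    · exact v1 e he
  · intro f hf
    rw [Tt_append]
    set c := (fun j => (f j).2) with hc
    have key := h0 (Tt ((st hk 0, Q0, α) :: (st hk 1, Q1, β) :: L1) (dl f))
      (fun i j => α * (β * Kv c {i, j} + (1 - β) * Kv c {i}) +
        (1 - α) * (β * Kv c {j} + (1 - β) * Kv c ∅)) (by
        intro g hg hgT i j hi hj
        have hij : i ≠ j := by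
          rintro rfl
          have := st_inj hk (hi.symm.trans hj)
          exact absurd this (by decide)
        have hr : ∀ l, (g l).1 = 0 := fun l => mem_row.1 (T0_row hk (hgT l))
        have hQ : ∀ Q : Fin 2 × Fin k, Q.1 = 1 → ∀ l, g l ≠ Q := by
          intro Q hQ1 l h
          have := hr l
          rw [h, hQ1] at this
          simp at this
        have hu0 := swap_update g hg i _ Q0 hi (hQ Q0 rfl)
        have hi0 := smul_inj (swap (st hk 0) Q0) g hg
        have hu1 := swap_update g hg j _ Q1 hj (hQ Q1 rfl)
        have hi1 := smul_inj (swap (st hk 1) Q1) g hg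
        rw [hu0] at hi0
        rw [hu1] at hi1
        have hu2 := swap_update (Function.update g i Q0) hi0 j (st hk 1) Q1
          (by rw [Function.update_of_ne hij.symm, hj])
          (by
            intro l
            by_cases hl : l = i
            · rw [hl, Function.update_self]; exact hQQ
            · rw [Function.update_of_ne hl]; exact hQ Q1 rfl l)
        have hi2 := smul_inj (swap (st hk 1) Q1) _ hi0
        rw [hu2] at hi2
        have m0 : ∀ g' : Fin 4 → Fin 2 × Fin k, (∀ l, g' l ∈ T0 hk ∪ {Q0, Q1}) →
            ∀ i', ∀ l, Function.update g' i' Q0 l ∈ T0 hk ∪ {Q0, Q1} := by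
          intro g' hg' i' l
          by_cases hl : l = i'
          · simp [hl]
          · rw [Function.update_of_ne hl]; exact hg' l
        have m1 : ∀ g' : Fin 4 → Fin 2 × Fin k, (∀ l, g' l ∈ T0 hk ∪ {Q0, Q1}) →
            ∀ i', ∀ l, Function.update g' i' Q1 l ∈ T0 hk ∪ {Q0, Q1} := by
          intro g' hg' i' l
          by_cases hl : l = i'
          · simp [hl]
          · rw [Function.update_of_ne hl]; exact hg' l
        have m : ∀ l, g l ∈ T0 hk ∪ {Q0, Q1} := fun l => Finset.mem_union_left _ (hgT l)
        simp only [Tt]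
        rw [hu0, hu1, hu2, h1 4 f _ hf hi2 (m1 _ (m0 _ m i) j), h1 4 f _ hf hi0 (m0 _ m i),
          h1 4 f _ hf hi1 (m1 _ m j), h1 4 f g hf hg m]
        have s0 : Finset.univ.filter (fun l => (g l).1 = 1) = ∅ := by
          ext l
          simp [hr]
        have s1 : Finset.univ.filter (fun l => (Function.update g i Q0 l).1 = 1) = {i} := by
          ext l
          by_cases hl : l = i <;> simp [Function.update_apply, hl, hr, Q0]
        have s2 : Finset.univ.filter (fun l => (Function.update g j Q1 l).1 = 1) = {j} := by
          ext l
          by_cases hl : l = j <;> simp [Function.update_apply, hl, hr, Q1]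
        have s3 : Finset.univ.filter
            (fun l => (Function.update (Function.update g i Q0) j Q1 l).1 = 1) = {i, j} := by
          ext l
          by_cases hl : l = j
          · simp [hl, Q1]
          · by_cases hl' : l = i <;> simp [Function.update_apply, hl, hl', hr, Q0]
            simp [hij]
        rw [s0, s1, s2, s3])
    have hdf : ((4:ℕ).descFactorial 2 : ℝ) = 12 := by norm_num [Nat.descFactorial]
    rw [hdf] at key
    have hkr2 : (((2 * k : ℕ)) : ℝ) = 2 * k := by push_cast; ring
    have S := sum4 c _ _ _ α β (1 / (2 * k * (2 * k - 1) * (2 * k - 2) * (2 * k - 3))) rfl rfl rfl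
      (by rw [df4 k hk, df3 k (by omega), df2 k (by omega), Nat.descFactorial_zero,
            Nat.descFactorial_one, Nat.cast_one]; exact N0)
      (by rw [df3 k (by omega), df2 k (by omega), Nat.descFactorial_one]; exact N1)
      (by rw [df2 k (by omega)]; exact N2)
      (three_cols f hf)
    rw [fact_ratio (2 * k) 4 (by omega), df4 (2 * k) (by omega), hkr2]
    linarith [key, S]

end
end UtD

theorem Ut_doubling_bounds :
    (∀ k : ℕ, 3 ≤ k → Ut 3 (2 * k) ≤ 5 * k - 3) ∧
    (∀ k : ℕ, 4 ≤ k → Ut 4 (2 * k) ≤ 7 * k - 5) :=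
  ⟨fun _ hk => UtD.three hk, fun _ hk => UtD.four hk⟩
end

section
/- For every integer n ≥ 3, Û_3(n) ≤ 2n + 5·log₂ n, and for every integer n ≥ 4, Û_4(n) ≤ 3n + 8·log₂ n. -/
open scoped BigOperators

section Aux

set_option linter.all false
set_option linter.unusedSectionVars false
set_option linter.unusedSimpArgs false

variable {α : Type*} [DecidableEq α]

/-- Expectation of `f` of the final occupied set, starting from the set `C`. -/
noncomputable def EE : List (α × α × ℝ) → (Finset α → ℝ) → Finset α → ℝ
  | [], f, C => f C
  | e :: L, f, C =>
      e.2.2 * EE L f (C.image (Equiv.swap e.1 e.2.1)) + (1 - e.2.2) * EE L f C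

theorem EE_append (L M : List (α × α × ℝ)) (f : Finset α → ℝ) (C : Finset α) :
    EE (L ++ M) f C = EE L (EE M f) C := by
  induction L generalizing C with
  | nil => rfl
  | cons e L ih => simp [EE, ih]

/-- Average over the `k`-subsets of `X`. -/
noncomputable def AA (k : ℕ) (X : Finset α) (g : Finset α → ℝ) : ℝ :=
  (∑ S ∈ X.powersetCard k, g S) / (X.card.choose k : ℝ)

/-- Validity of a lazy transposition. -/
def VV (e : α × α × ℝ) : Prop := e.1 ≠ e.2.1 ∧ 0 ≤ e.2.2 ∧ e.2.2 ≤ 1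

/-- `L` makes every subset of the buffer `B` uniform in `X`. -/
def Spec (X B : Finset α) (L : List (α × α × ℝ)) : Prop :=
  ∀ (f : Finset α → ℝ) (C Y : Finset α), C ⊆ B → Disjoint X Y →
    EE L f (C ∪ Y) = AA C.card X (fun S => f (S ∪ Y))

/-- Coding of subsets. -/
def cd (x : Bool) (a : α) : Finset α := if x then {a} else ∅

theorem mem_cd (x : Bool) (a t : α) : t ∈ cd x a ↔ x = true ∧ t = a := by
  unfold cd; cases x <;> simp

theorem mem_image_swap (a b t : α) (S : Finset α) :
    t ∈ S.image (Equiv.swap a b) ↔ Equiv.swap a b t ∈ S := by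
  constructor
  · intro h
    obtain ⟨s, hs, rfl⟩ := Finset.mem_image.1 h
    simpa using hs
  · intro h
    exact Finset.mem_image.2 ⟨_, h, by simp⟩

theorem swap_pair (a b : α) (Z : Finset α) (hab : a ≠ b) (ha : a ∉ Z) (hb : b ∉ Z) (x y : Bool) :
    (cd x a ∪ cd y b ∪ Z).image (Equiv.swap a b) = cd y a ∪ cd x b ∪ Z := by
  ext t
  rw [mem_image_swap]
  simp only [Finset.mem_union, mem_cd]
  by_cases h1 : t = a
  · subst h1; simp [hab, hab.symm, ha, hb]
  by_cases h2 : t = b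
  · subst h2; simp [hab, hab.symm, ha, hb]
  rw [Equiv.swap_apply_of_ne_of_ne h1 h2]; simp [h1, h2]

theorem image_swap_eq_self (a b : α) (Z : Finset α) (ha : a ∉ Z) (hb : b ∉ Z) :
    Z.image (Equiv.swap a b) = Z := by
  ext t
  rw [mem_image_swap]
  by_cases h1 : t = a
  · subst h1; simp [ha, hb]
  by_cases h2 : t = b
  · subst h2; simp [ha, hb]
  rw [Equiv.swap_apply_of_ne_of_ne h1 h2]

/-- moving step, source filled -/
theorem EE_move (d r : α) (p : ℝ) (L : List (α × α × ℝ)) (f : Finset α → ℝ) (C W : Finset α)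
    (hd : d ∈ C) (hdW : d ∉ W) (hr : r ∉ C) (hrW : r ∉ W) :
    EE ((d, r, p) :: L) f (C ∪ W) =
      p * EE L f (C.erase d ∪ insert r W) + (1 - p) * EE L f (C ∪ W) := by
  have : (C ∪ W).image (Equiv.swap d r) = C.erase d ∪ insert r W := by
    ext t
    rw [mem_image_swap]
    by_cases h1 : t = d
    · subst h1
      have : t ≠ r := by rintro rfl; exact hr hd
      simp [hr, hrW, this, hdW]
    by_cases h2 : t = r
    · subst h2; simp [hd]
    rw [Equiv.swap_apply_of_ne_of_ne h1 h2]; simp [h1, h2]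
  simp [EE, this]

theorem EE_stay (d r : α) (p : ℝ) (L : List (α × α × ℝ)) (f : Finset α → ℝ) (W : Finset α)
    (hd : d ∉ W) (hr : r ∉ W) :
    EE ((d, r, p) :: L) f W = EE L f W := by
  simp only [EE, image_swap_eq_self d r W hd hr]; ring

theorem sum_split (P Q : Finset α) (hPQ : Disjoint P Q) (k : ℕ) (g : Finset α → ℝ) :
    ∑ S ∈ (P ∪ Q).powersetCard k, g S =
      ∑ ij ∈ Finset.HasAntidiagonal.antidiagonal k, ∑ S ∈ P.powersetCard ij.1, ∑ T ∈ Q.powersetCard ij.2,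
        g (S ∪ T) := by
  simp_rw [← Finset.sum_product']
  rw [Finset.sum_sigma']
  symm
  refine Finset.sum_bij' (fun z _ => z.2.1 ∪ z.2.2)
    (fun S _ => ⟨((S ∩ P).card, (S ∩ Q).card), (S ∩ P, S ∩ Q)⟩) ?_ ?_ ?_ ?_ ?_
  · rintro ⟨⟨i, j⟩, S, T⟩ h
    simp only [Finset.mem_sigma, Finset.HasAntidiagonal.mem_antidiagonal, Finset.mem_product,
      Finset.mem_powersetCard] at h ⊢
    obtain ⟨h1, ⟨h2, h3⟩, h4, h5⟩ := h
    refine ⟨Finset.union_subset_union h2 h4, ?_⟩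
    rw [Finset.card_union_of_disjoint (Finset.disjoint_of_subset_left h2
      (Finset.disjoint_of_subset_right h4 hPQ))]
    omega
  · intro S h
    simp only [Finset.mem_sigma, Finset.HasAntidiagonal.mem_antidiagonal, Finset.mem_product,
      Finset.mem_powersetCard] at h ⊢
    refine ⟨?_, ⟨Finset.inter_subset_right, trivial⟩, Finset.inter_subset_right, trivial⟩
    rw [← Finset.card_union_of_disjoint, ← Finset.inter_union_distrib_left,
      Finset.inter_eq_left.2 h.1, h.2]
    exact Finset.disjoint_of_subset_left Finset.inter_subset_right
      (Finset.disjoint_of_subset_right Finset.inter_subset_right hPQ)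
  · rintro ⟨⟨i, j⟩, S, T⟩ h
    simp only [Finset.mem_sigma, Finset.HasAntidiagonal.mem_antidiagonal, Finset.mem_product,
      Finset.mem_powersetCard] at h
    obtain ⟨h1, ⟨h2, h3⟩, h4, h5⟩ := h
    have e1 : (S ∪ T) ∩ P = S := by
      ext t; have := @h2 t; have := @h4 t
      have dj := Finset.disjoint_left.1 hPQ; have := @dj t
      simp only [Finset.mem_inter, Finset.mem_union]; tauto
    have e2 : (S ∪ T) ∩ Q = T := by
      ext t; have := @h2 t; have := @h4 t
      have dj := Finset.disjoint_left.1 hPQ; have := @dj t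
      simp only [Finset.mem_inter, Finset.mem_union]; tauto
    subst h3 h5
    simp only [e1, e2]
  · intro S h
    simp only [Finset.mem_powersetCard] at h
    simp only
    rw [← Finset.inter_union_distrib_left, Finset.inter_eq_left.2 h.1]
  · intros; rfl

/-- a swap inside `X` preserves the uniform average -/
theorem sum_swap (X Y : Finset α) (hXY : Disjoint X Y) (x y : α) (hx : x ∈ X) (hy : y ∈ X) (k : ℕ)
    (f : Finset α → ℝ) :
    ∑ S ∈ X.powersetCard k, f ((S ∪ Y).image (Equiv.swap x y)) =
      ∑ S ∈ X.powersetCard k, f (S ∪ Y) := by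
  have hxY := Finset.disjoint_left.1 hXY hx
  have hyY := Finset.disjoint_left.1 hXY hy
  have key : ∀ S ∈ X.powersetCard k, S.image (Equiv.swap x y) ∈ X.powersetCard k := by
    intro S hS
    rw [Finset.mem_powersetCard] at hS ⊢
    refine ⟨?_, by rw [Finset.card_image_of_injective _ (Equiv.injective _), hS.2]⟩
    intro t ht
    rw [mem_image_swap] at ht
    by_cases h1 : t = x
    · subst h1; exact hx
    by_cases h2 : t = y
    · subst h2; exact hy
    rw [Equiv.swap_apply_of_ne_of_ne h1 h2] at ht
    exact hS.1 ht
  have inv : ∀ S : Finset α, (S.image (Equiv.swap x y)).image (Equiv.swap x y) = S := by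
    intro S; ext t; simp [mem_image_swap]
  refine Finset.sum_bij' (fun S _ => S.image (Equiv.swap x y)) (fun S _ => S.image (Equiv.swap x y))
    key key (fun S _ => inv S) (fun S _ => inv S) ?_
  intro S _
  rw [Finset.image_union, image_swap_eq_self x y Y hxY hyY]

theorem sum_EE (X Y : Finset α) (hXY : Disjoint X Y) (k : ℕ) (f : Finset α → ℝ)
    (L : List (α × α × ℝ)) (hL : ∀ e ∈ L, e.1 ∈ X ∧ e.2.1 ∈ X) :
    ∑ S ∈ X.powersetCard k, EE L f (S ∪ Y) = ∑ S ∈ X.powersetCard k, f (S ∪ Y) := by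
  induction L with
  | nil => rfl
  | cons e L ih =>
    have h1 := hL e (by simp)
    have ih := ih (fun e he => hL e (by simp [he]))
    simp only [EE]
    rw [Finset.sum_add_distrib, ← Finset.mul_sum, ← Finset.mul_sum,
      sum_swap X Y hXY _ _ h1.1 h1.2 k (EE L f), ih]
    ring

/-- the list of half-half flips of a list of pairs -/
noncomputable def flips (l : List (α × α)) : List (α × α × ℝ) :=
  l.map (fun z => (z.1, z.2, 1/2))

/-- the product of all swaps -/
def swaps (l : List (α × α)) : Equiv.Perm α := (l.map (fun z => Equiv.swap z.1 z.2)).prod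

/-- two pairs are disjoint -/
def Dj (z w : α × α) : Prop := z.1 ≠ w.1 ∧ z.1 ≠ w.2 ∧ z.2 ≠ w.1 ∧ z.2 ≠ w.2

theorem image_swap_comm (z w : α × α) (h : Dj z w) (S : Finset α) :
    (S.image (Equiv.swap w.1 w.2)).image (Equiv.swap z.1 z.2) =
    (S.image (Equiv.swap z.1 z.2)).image (Equiv.swap w.1 w.2) := by
  obtain ⟨h1, h2, h3, h4⟩ := h
  ext t
  simp only [mem_image_swap]
  have : Equiv.swap w.1 w.2 (Equiv.swap z.1 z.2 t) = Equiv.swap z.1 z.2 (Equiv.swap w.1 w.2 t) := by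
    simp only [Equiv.swap_apply_def]
    split_ifs <;> simp_all
  rw [this]

theorem flips_inv (l : List (α × α)) (hl : l.Pairwise Dj) (f : Finset α → ℝ) (w : α × α)
    (hw : w ∈ l) (S : Finset α) :
    EE (flips l) f (S.image (Equiv.swap w.1 w.2)) = EE (flips l) f S := by
  induction l generalizing S with
  | nil => simp at hw
  | cons z l ih =>
    rw [List.pairwise_cons] at hl
    have inv : ∀ S : Finset α, (S.image (Equiv.swap z.1 z.2)).image (Equiv.swap z.1 z.2) = S := by
      intro S; ext t; simp [mem_image_swap]
    simp only [flips, List.map_cons, EE]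
    rw [List.mem_cons] at hw
    rcases hw with rfl | hw
    · rw [inv]; ring
    · have hd := hl.1 w hw
      rw [image_swap_comm z w hd]
      have := ih hl.2 hw
      simp only [flips] at this
      rw [this, this]

theorem flips_swaps (l : List (α × α)) (hl : l.Pairwise Dj) (f : Finset α → ℝ) (S : Finset α) :
    EE (flips l) f (S.image (swaps l)) = EE (flips l) f S := by
  have key : ∀ m : List (α × α), m ⊆ l → ∀ S, EE (flips l) f (S.image (swaps m)) =
      EE (flips l) f S := by
    intro m
    induction m with
    | nil => intro _ S; simp [swaps]
    | cons z m ih =>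
      intro hm S
      have h2 : S.image (swaps (z :: m)) = (S.image (swaps m)).image (Equiv.swap z.1 z.2) := by
        rw [Finset.image_image]; rfl
      rw [h2, flips_inv l hl f z (hm (by simp)), ih (fun w hw => hm (by simp [hw]))]
  exact key l (List.Subset.refl l) S


theorem exists_pairs (m : ℕ) : ∀ P Q : Finset α, Disjoint P Q → P.card = m → Q.card = m →
    ∃ l : List (α × α), l.length = m ∧ l.Pairwise Dj ∧ (∀ z ∈ l, z.1 ∈ P ∧ z.2 ∈ Q) ∧
      (∀ x, x ∈ P → swaps l x ∈ Q) ∧ (∀ x, x ∈ Q → swaps l x ∈ P) ∧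
      (∀ x, x ∉ P → x ∉ Q → swaps l x = x) ∧ (∀ x, swaps l (swaps l x) = x) := by
  induction m with
  | zero =>
    intro P Q _ hP hQ
    rw [Finset.card_eq_zero] at hP hQ
    subst hP hQ
    exact ⟨[], by simp [swaps]⟩
  | succ m ih =>
    intro P Q hPQ hP hQ
    obtain ⟨x, hx⟩ : P.Nonempty := Finset.card_pos.1 (by omega)
    obtain ⟨y, hy⟩ : Q.Nonempty := Finset.card_pos.1 (by omega)
    have dj := Finset.disjoint_left.1 hPQ
    obtain ⟨l, h1, h2, h3, h4, h5, h6, h7⟩ := ih (P.erase x) (Q.erase y)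
      (Finset.disjoint_of_subset_left (Finset.erase_subset _ _)
        (Finset.disjoint_of_subset_right (Finset.erase_subset _ _) hPQ))
      (by rw [Finset.card_erase_of_mem hx]; omega) (by rw [Finset.card_erase_of_mem hy]; omega)
    have hxy : x ≠ y := by rintro rfl; exact dj hx hy
    have hxQ : x ∉ Q := dj hx
    have hyP : y ∉ P := fun h => dj h hy
    have sx : swaps l x = x := h6 x (by simp) (by simp [hxQ])
    have sy : swaps l y = y := h6 y (by simp [hyP]) (by simp)
    have e : ∀ t, swaps ((x, y) :: l) t = Equiv.swap x y (swaps l t) := by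
      intro t; simp [swaps]
    have cP : ∀ t, t ∈ P → t ≠ x → swaps ((x, y) :: l) t = swaps l t ∧ swaps l t ∈ Q.erase y := by
      intro t ht htx
      have := h4 t (by simp [ht, htx])
      refine ⟨?_, this⟩
      rw [e, Equiv.swap_apply_of_ne_of_ne]
      · rintro h; rw [h] at this; simp [hxQ] at this
      · rintro h; rw [h] at this; simp at this
    have cQ : ∀ t, t ∈ Q → t ≠ y → swaps ((x, y) :: l) t = swaps l t ∧ swaps l t ∈ P.erase x := by
      intro t ht htx
      have := h5 t (by simp [ht, htx])
      refine ⟨?_, this⟩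
      rw [e, Equiv.swap_apply_of_ne_of_ne]
      · rintro h; rw [h] at this; simp at this
      · rintro h; rw [h] at this; simp [hyP] at this
    have ex : swaps ((x, y) :: l) x = y := by rw [e, sx]; simp
    have ey : swaps ((x, y) :: l) y = x := by rw [e, sy]; simp
    have eo : ∀ t, t ∉ P → t ∉ Q → swaps ((x, y) :: l) t = t := by
      intro t hp hq
      rw [e, h6 t (by simp [hp]) (by simp [hq]), Equiv.swap_apply_of_ne_of_ne]
      · rintro rfl; exact hp hx
      · rintro rfl; exact hq hy
    refine ⟨(x, y) :: l, by simp [h1], ?_, ?_, ?_, ?_, eo, ?_⟩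
    · rw [List.pairwise_cons]
      refine ⟨?_, h2⟩
      intro z hz
      have := h3 z hz
      simp only [Finset.mem_erase] at this
      obtain ⟨⟨a1, a2⟩, a3, a4⟩ := this
      refine ⟨fun h => a1 h.symm, ?_, ?_, fun h => a3 h.symm⟩
      · intro h; simp only at h; rw [← h] at a4; exact hxQ a4
      · intro h; simp only at h; rw [← h] at a2; exact hyP a2
    · intro z hz
      rw [List.mem_cons] at hz
      rcases hz with rfl | hz
      · exact ⟨hx, hy⟩
      · have := h3 z hz
        exact ⟨Finset.mem_of_mem_erase this.1, Finset.mem_of_mem_erase this.2⟩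
    · intro t ht
      by_cases h : t = x
      · subst h; rw [ex]; exact hy
      · rw [(cP t ht h).1]; exact Finset.mem_of_mem_erase (cP t ht h).2
    · intro t ht
      by_cases h : t = y
      · subst h; rw [ey]; exact hx
      · rw [(cQ t ht h).1]; exact Finset.mem_of_mem_erase (cQ t ht h).2
    · intro t
      by_cases ht : t ∈ P
      · by_cases h : t = x
        · subst h; rw [ex, ey]
        · obtain ⟨b1, b2⟩ := cP t ht h
          rw [Finset.mem_erase] at b2
          rw [b1, (cQ _ b2.2 b2.1).1, h7]
      by_cases ht' : t ∈ Q
      · by_cases h : t = y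
        · subst h; rw [ey, ex]
        · obtain ⟨b1, b2⟩ := cQ t ht' h
          rw [Finset.mem_erase] at b2
          rw [b1, (cP _ b2.2 b2.1).1, h7]
      rw [eo t ht ht', eo t ht ht']

theorem choose_pos_real {m i : ℕ} (h : i ≤ m) : (m.choose i : ℝ) ≠ 0 := by
  have := Nat.choose_pos h
  positivity

theorem even_core (m : ℕ) (P Q BP BQ : Finset α) (hPQ : Disjoint P Q) (hP : P.card = m)
    (hQ : Q.card = m) (LP LQ : List (α × α × ℝ)) (hLP : Spec P BP LP) (hLQ : Spec Q BQ LQ)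
    (hBQ : BQ ⊆ Q) :
    ∃ F : List (α × α × ℝ), F.length = m ∧ (∀ e ∈ F, VV e) ∧
    ∀ (f : Finset α → ℝ) (Y : Finset α), Disjoint (P ∪ Q) Y →
    ∃ H : ℕ → ℕ → ℝ, (∀ i j, H i j = H j i) ∧
      (∀ C D, C ⊆ BP → D ⊆ BQ → EE (LP ++ (LQ ++ F)) f (C ∪ (D ∪ Y)) = H C.card D.card) ∧
      ∀ k ≤ m, AA k (P ∪ Q) (fun S => f (S ∪ Y)) =
        (∑ ij ∈ Finset.HasAntidiagonal.antidiagonal k,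
          (m.choose ij.1 : ℝ) * (m.choose ij.2) * H ij.1 ij.2) / ((2 * m).choose k : ℝ) := by
  obtain ⟨l, h1, h2, h3, h4, h5, h6, h7⟩ := exists_pairs m P Q hPQ hP hQ
  refine ⟨flips l, by simp [flips, h1], ?_, ?_⟩
  · intro e he
    simp only [flips, List.mem_map] at he
    obtain ⟨z, hz, rfl⟩ := he
    refine ⟨?_, by norm_num, by norm_num⟩
    intro h
    have := h3 z hz
    simp only at h
    rw [← h] at this
    exact Finset.disjoint_left.1 hPQ this.1 this.2
  intro f Y hY
  have hPY : Disjoint P Y := Finset.disjoint_of_subset_left Finset.subset_union_left hY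
  have hQY : Disjoint Q Y := Finset.disjoint_of_subset_left Finset.subset_union_right hY
  set g : Finset α → ℝ := fun S => EE (flips l) f (S ∪ Y) with hg
  have imY : Y.image (swaps l) = Y := by
    ext t
    rw [Finset.mem_image]
    constructor
    · rintro ⟨s, hs, rfl⟩
      rwa [h6 s (fun h => Finset.disjoint_left.1 hPY h hs)
        (fun h => Finset.disjoint_left.1 hQY h hs)]
    · intro hs
      exact ⟨t, hs, h6 t (fun h => Finset.disjoint_left.1 hPY h hs)
        (fun h => Finset.disjoint_left.1 hQY h hs)⟩
  have ginv : ∀ S, g (S.image (swaps l)) = g S := by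
    intro S
    have := flips_swaps l h2 f (S ∪ Y)
    rwa [Finset.image_union, imY] at this
  have invo : ∀ S : Finset α, (S.image (swaps l)).image (swaps l) = S := by
    intro S
    rw [Finset.image_image]
    have : (⇑(swaps l) ∘ ⇑(swaps l)) = id := by funext t; exact h7 t
    rw [this, Finset.image_id]
  have mP : ∀ i S, S ∈ P.powersetCard i → S.image (swaps l) ∈ Q.powersetCard i := by
    intro i S hS
    rw [Finset.mem_powersetCard] at hS ⊢
    refine ⟨?_, by rw [Finset.card_image_of_injective _ (Equiv.injective _), hS.2]⟩
    intro t ht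
    obtain ⟨s, hs, rfl⟩ := Finset.mem_image.1 ht
    exact h4 s (hS.1 hs)
  have mQ : ∀ i S, S ∈ Q.powersetCard i → S.image (swaps l) ∈ P.powersetCard i := by
    intro i S hS
    rw [Finset.mem_powersetCard] at hS ⊢
    refine ⟨?_, by rw [Finset.card_image_of_injective _ (Equiv.injective _), hS.2]⟩
    intro t ht
    obtain ⟨s, hs, rfl⟩ := Finset.mem_image.1 ht
    exact h5 s (hS.1 hs)
  set HS : ℕ → ℕ → ℝ := fun i j => ∑ S ∈ P.powersetCard i, ∑ T ∈ Q.powersetCard j, g (S ∪ T)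
    with hHS
  have HSsymm : ∀ i j, HS i j = HS j i := by
    intro i j
    simp only [hHS]
    rw [← Finset.sum_product', ← Finset.sum_product']
    refine Finset.sum_bij' (fun z _ => (z.2.image (swaps l), z.1.image (swaps l)))
      (fun z _ => (z.2.image (swaps l), z.1.image (swaps l))) ?_ ?_ ?_ ?_ ?_
    · intro z hz
      rw [Finset.mem_product] at hz ⊢
      exact ⟨mQ _ _ hz.2, mP _ _ hz.1⟩
    · intro z hz
      rw [Finset.mem_product] at hz ⊢
      exact ⟨mQ _ _ hz.2, mP _ _ hz.1⟩
    · intro z hz; simp only [invo]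
    · intro z hz; simp only [invo]
    · intro z hz
      simp only
      rw [← Finset.image_union, ginv, Finset.union_comm]
  refine ⟨fun i j => HS i j / ((m.choose i : ℝ) * m.choose j), ?_, ?_, ?_⟩
  · intro i j
    simp only
    rw [HSsymm, mul_comm]
  · intro C D hC hD
    have hDQ : D ⊆ Q := hD.trans hBQ
    rw [EE_append, hLP _ C (D ∪ Y) hC (by
      rw [Finset.disjoint_union_right]
      exact ⟨Finset.disjoint_of_subset_right hDQ hPQ, hPY⟩)]
    unfold AA
    have : ∀ S ∈ P.powersetCard C.card, EE (LQ ++ flips l) f (S ∪ (D ∪ Y)) =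
        (∑ T ∈ Q.powersetCard D.card, g (S ∪ T)) / (m.choose D.card : ℝ) := by
      intro S hS
      rw [Finset.mem_powersetCard] at hS
      have e : S ∪ (D ∪ Y) = D ∪ (S ∪ Y) := by ac_rfl
      rw [e, EE_append, hLQ _ D (S ∪ Y) hD (by
        rw [Finset.disjoint_union_right]
        exact ⟨(Finset.disjoint_of_subset_left hS.1 hPQ).symm, hQY⟩)]
      unfold AA
      rw [hQ]
      congr 1
      refine Finset.sum_congr rfl fun T _ => ?_
      simp only [hg]
      congr 1
      ac_rfl
    rw [Finset.sum_congr rfl this, ← Finset.sum_div, hP]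
    simp only [hHS]
    rw [div_div, mul_comm]
  · intro k hk
    unfold AA
    rw [Finset.card_union_of_disjoint hPQ, hP, hQ, ← two_mul]
    congr 1
    rw [← sum_EE (P ∪ Q) Y hY k f (flips l)]
    · rw [sum_split P Q hPQ k (fun S => EE (flips l) f (S ∪ Y))]
      refine Finset.sum_congr rfl ?_
      rintro ⟨i, j⟩ hij
      have hij' := Finset.HasAntidiagonal.mem_antidiagonal.1 hij
      simp only at hij' ⊢
      have c1 := choose_pos_real (m := m) (i := i) (by omega)
      have c2 := choose_pos_real (m := m) (i := j) (by omega)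
      rw [mul_div_cancel₀ _ (mul_ne_zero c1 c2)]
    · intro e he
      simp only [flips, List.mem_map] at he
      obtain ⟨z, hz, rfl⟩ := he
      have := h3 z hz
      exact ⟨Finset.mem_union_left _ this.1, Finset.mem_union_right _ this.2⟩

/-- adding one new position -/
theorem add_core (X B : Finset α) (M L : List (α × α × ℝ)) (hM : Spec B B M) (hL : Spec X B L)
    (hB : B ⊆ X) (b z : α) (hb : b ∈ B) (hz : z ∉ X) :
    Spec (insert z X) B (M ++ (b, z, (B.card : ℝ) / (X.card + 1)) :: L) := by
  intro f C Y hC hXY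
  rw [Finset.disjoint_insert_left] at hXY
  obtain ⟨hzY, hXY⟩ := hXY
  have hBY : Disjoint B Y := Finset.disjoint_of_subset_left hB hXY
  rw [EE_append, hM _ C Y hC hBY]
  set t := B.card with ht
  set n := X.card with hn
  set k := C.card with hk
  have hkt : k ≤ t := Finset.card_le_card hC
  have htn : t ≤ n := Finset.card_le_card hB
  have ht0 : 0 < t := Finset.card_pos.2 ⟨b, hb⟩
  rcases Nat.eq_zero_or_pos k with h0 | h0
  · rw [h0]
    simp only [AA, Finset.powersetCard_zero, Finset.sum_singleton, Nat.choose_zero_right,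
      Finset.empty_union]
    rw [EE_stay]
    · have := hL f ∅ Y (by simp) hXY
      simp only [AA, Finset.powersetCard_zero, Finset.sum_singleton, Nat.choose_zero_right,
        Finset.empty_union, Finset.card_empty] at this
      rw [this]; simp
    · exact Finset.disjoint_left.1 hBY hb
    · exact hzY
  obtain ⟨j, hj⟩ : ∃ j, k = j + 1 := ⟨k - 1, by omega⟩
  set A1 := AA k X (fun S => f (S ∪ Y)) with hA1
  set A0 := AA j X (fun S => f (S ∪ insert z Y)) with hA0
  have hXzY : Disjoint X (insert z Y) := by
    rw [Finset.disjoint_insert_right]; exact ⟨hz, hXY⟩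
  have val : ∀ S ∈ B.powersetCard k,
      EE ((b, z, (t : ℝ) / (n + 1)) :: L) f (S ∪ Y) =
        A1 + (if b ∈ S then (t : ℝ) / (n + 1) * (A0 - A1) else 0) := by
    intro S hS
    rw [Finset.mem_powersetCard] at hS
    have hbY := Finset.disjoint_left.1 hBY hb
    have hzS : z ∉ S := fun h => hz (hB (hS.1 h))
    by_cases h : b ∈ S
    · rw [EE_move b z _ L f S Y h hbY hzS hzY,
        hL f _ _ ((Finset.erase_subset _ _).trans hS.1) hXzY, hL f _ _ hS.1 hXY,
        Finset.card_erase_of_mem h, hS.2, if_pos h, hj]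
      simp only [Nat.add_sub_cancel]
      rw [← hj, ← hA1, ← hA0]
      ring
    · rw [EE_stay b z _ L f _ (by simp [h, hbY]) (by simp [hzS, hzY]), hL f _ _ hS.1 hXY, hS.2,
        if_neg h, add_zero]
  have cnt : ((B.powersetCard k).filter (fun S => b ∈ S)).card = (t - 1).choose j := by
    have := Finset.card_filter_powersetCard_subset {b} B k (by simpa using hb) (by simp; omega)
    simp only [Finset.singleton_subset_iff, Finset.card_singleton] at this
    rw [this, hj, Nat.add_sub_cancel]
  have hsum : ∑ S ∈ B.powersetCard k, EE ((b, z, (t : ℝ) / (n + 1)) :: L) f (S ∪ Y) =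
      (t.choose k : ℝ) * A1 + ((t - 1).choose j : ℝ) * ((t : ℝ) / (n + 1) * (A0 - A1)) := by
    rw [Finset.sum_congr rfl val, Finset.sum_add_distrib, ← Finset.sum_filter, Finset.sum_const,
      Finset.sum_const, cnt, Finset.card_powersetCard, ← ht]
    simp
  have c1 := choose_pos_real (m := t) (i := k) hkt
  have c2 := choose_pos_real (m := n) (i := k) (by omega)
  have c3 := choose_pos_real (m := n) (i := j) (by omega)
  have c4 := choose_pos_real (m := n + 1) (i := k) (by omega)
  have rhs : AA k (insert z X) (fun S => f (S ∪ Y)) =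
      ((n.choose k : ℝ) * A1 + (n.choose j : ℝ) * A0) / ((n + 1).choose k : ℝ) := by
    unfold AA
    rw [Finset.card_insert_of_notMem hz]
    congr 1
    have : insert z X = {z} ∪ X := rfl
    rw [hj, Finset.powersetCard_succ_insert hz, Finset.sum_union, Finset.sum_image]
    · rw [← hj, hA1, hA0, AA, AA, ← hn, mul_div_cancel₀ _ c2, mul_div_cancel₀ _ c3]
      congr 1
      · rw [hj]
      refine Finset.sum_congr rfl fun S _ => ?_
      congr 1
      simp [Finset.union_insert, Finset.insert_union]
    · intro S hS T hT h
      simp only [Finset.mem_coe, Finset.mem_powersetCard] at hS hT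
      have hzS : z ∉ S := fun h => hz (hS.1 h)
      have hzT : z ∉ T := fun h => hz (hT.1 h)
      rw [← Finset.erase_insert hzS, ← Finset.erase_insert hzT, h]
    · rw [Finset.disjoint_left]
      intro S hS hS'
      rw [Finset.mem_powersetCard] at hS
      obtain ⟨T, _, rfl⟩ := Finset.mem_image.1 hS'
      exact hz (hS.1 (by simp))
  rw [rhs]
  unfold AA
  rw [hsum, ← ht]
  have e1 : (t : ℝ) * ((t - 1).choose j : ℝ) = (t.choose k : ℝ) * k := by
    have := Nat.add_one_mul_choose_eq (t - 1) j
    rw [Nat.sub_add_cancel ht0] at this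
    rw [hj]; exact_mod_cast this
  have e2 : ((n : ℝ) + 1) * (n.choose j : ℝ) = ((n + 1).choose k : ℝ) * k := by
    have := Nat.add_one_mul_choose_eq n j
    rw [hj]; exact_mod_cast this
  have e3 : ((n + 1).choose k : ℝ) = n.choose j + n.choose k := by
    rw [hj]; exact_mod_cast Nat.choose_succ_succ n j
  have hn1 : (n : ℝ) + 1 ≠ 0 := by positivity
  have l1 : ((t.choose k : ℝ) * A1 + ((t - 1).choose j : ℝ) * ((t : ℝ) / (n + 1) * (A0 - A1))) /
      (t.choose k : ℝ) = A1 + k / (n + 1) * (A0 - A1) := by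
    field_simp
    linear_combination (A0 - A1) * e1
  rw [l1, eq_div_iff c4]
  have e4 : (n.choose j : ℝ) = ((n + 1).choose k : ℝ) * (k / (n + 1)) := by
    field_simp; linear_combination e2
  have e5 : (n.choose k : ℝ) = ((n + 1).choose k : ℝ) * (1 - k / (n + 1)) := by
    linear_combination -e3 - e4
  rw [e5, e4]
  ring

theorem sumPC_zero (X : Finset α) (g : Finset α → ℝ) : ∑ S ∈ X.powersetCard 0, g S = g ∅ := by
  simp

theorem sumPC_empty (k : ℕ) (g : Finset α → ℝ) :
    ∑ S ∈ (∅ : Finset α).powersetCard (k + 1), g S = 0 := by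
  rw [Finset.powersetCard_eq_empty.2 (by simp)]; simp

theorem sumPC_insert (k : ℕ) (z : α) (X : Finset α) (hz : z ∉ X) (g : Finset α → ℝ) :
    ∑ S ∈ (insert z X).powersetCard (k + 1), g S =
      ∑ S ∈ X.powersetCard (k + 1), g S + ∑ S ∈ X.powersetCard k, g (insert z S) := by
  rw [Finset.powersetCard_succ_insert hz, Finset.sum_union, Finset.sum_image]
  · intro S hS T hT h
    simp only [Finset.mem_coe, Finset.mem_powersetCard] at hS hT
    have hzS : z ∉ S := fun h => hz (hS.1 h)
    have hzT : z ∉ T := fun h => hz (hT.1 h)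
    rw [← Finset.erase_insert hzS, ← Finset.erase_insert hzT, h]
  · rw [Finset.disjoint_left]
    intro S hS hS'
    rw [Finset.mem_powersetCard] at hS
    obtain ⟨T, _, rfl⟩ := Finset.mem_image.1 hS'
    exact hz (hS.1 (by simp))

theorem sumPC_single (k : ℕ) (z : α) (g : Finset α → ℝ) :
    ∑ S ∈ ({z} : Finset α).powersetCard (k + 1), g S =
      ∑ S ∈ (∅ : Finset α).powersetCard k, g (insert z S) := by
  have := sumPC_insert k z ∅ (by simp) g
  rw [sumPC_empty, zero_add] at this
  exact this

/-- coded subset of three positions -/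
def c3 (a b c : α) (Y : Finset α) (x y z : Bool) : Finset α := cd x a ∪ cd y b ∪ (cd z c ∪ Y)

/-- coded subset of four positions -/
def c4 (a b c d : α) (Y : Finset α) (x y z w : Bool) : Finset α :=
  cd x a ∪ cd y b ∪ (cd z c ∪ (cd w d ∪ Y))

theorem sub3 (a b c : α) (C : Finset α) (hC : C ⊆ {a, b, c}) :
    ∃ x y z, C = cd x a ∪ cd y b ∪ cd z c := by
  refine ⟨decide (a ∈ C), decide (b ∈ C), decide (c ∈ C), ?_⟩
  ext t
  have := @hC t
  simp only [Finset.mem_insert, Finset.mem_singleton] at this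
  simp only [Finset.mem_union, mem_cd, decide_eq_true_eq]
  constructor
  · intro h
    rcases this h with rfl | rfl | rfl <;> simp [h]
  · rintro ((⟨h, rfl⟩ | ⟨h, rfl⟩) | ⟨h, rfl⟩) <;> exact h

theorem sub4 (a b c d : α) (C : Finset α) (hC : C ⊆ {a, b, c, d}) :
    ∃ x y z w, C = cd x a ∪ cd y b ∪ (cd z c ∪ cd w d) := by
  refine ⟨decide (a ∈ C), decide (b ∈ C), decide (c ∈ C), decide (d ∈ C), ?_⟩
  ext t
  have := @hC t
  simp only [Finset.mem_insert, Finset.mem_singleton] at this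
  simp only [Finset.mem_union, mem_cd, decide_eq_true_eq]
  constructor
  · intro h
    rcases this h with rfl | rfl | rfl | rfl <;> simp [h]
  · rintro ((⟨h, rfl⟩ | ⟨h, rfl⟩) | (⟨h, rfl⟩ | ⟨h, rfl⟩)) <;> exact h

theorem step_ab (a b : α) (Z : Finset α) (hab : a ≠ b) (ha : a ∉ Z) (hb : b ∉ Z) (x y : Bool)
    (p : ℝ) (L : List (α × α × ℝ)) (f : Finset α → ℝ) :
    EE ((a, b, p) :: L) f (cd x a ∪ cd y b ∪ Z) =
      p * EE L f (cd y a ∪ cd x b ∪ Z) + (1 - p) * EE L f (cd x a ∪ cd y b ∪ Z) := by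
  simp only [EE, swap_pair a b Z hab ha hb x y]

theorem mix1 (r : α) : Spec {r} {r} ([] : List (α × α × ℝ)) := by
  intro f C Y hC hY
  rcases Finset.subset_singleton_iff.1 hC with rfl | rfl
  · simp [EE, AA]
  · simp [EE, AA, sumPC_single]

theorem mix2 (a b : α) (hab : a ≠ b) : Spec {a, b} {a, b} [(a, b, 1/2)] := by
  intro f C Y hC hY
  have ha : a ∉ Y := fun h => Finset.disjoint_left.1 hY (by simp) h
  have hb : b ∉ Y := fun h => Finset.disjoint_left.1 hY (by simp) h
  obtain ⟨x, y, z, rfl⟩ := sub3 a b b C (by simpa using hC)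
  have : cd x a ∪ cd y b ∪ cd z b ∪ Y = cd x a ∪ cd (y || z) b ∪ Y := by
    cases y <;> cases z <;> simp [cd]
  rw [this, step_ab a b Y hab ha hb]
  cases x <;> cases y <;> cases z <;>
    simp [EE, AA, cd, sumPC_single, sumPC_insert, sumPC_empty, hab] <;> ring

/-- full mixing list of three positions -/
noncomputable def M3 (a b c : α) : List (α × α × ℝ) :=
  [(a, b, 1/2), (b, c, 2/3), (a, b, 1/2)]

theorem step3_ab (a b c : α) (Y : Finset α) (hab : a ≠ b) (hac : a ≠ c) (hbc : b ≠ c)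
    (ha : a ∉ Y) (hb : b ∉ Y) (x y z : Bool)
    (p : ℝ) (L : List (α × α × ℝ)) (f : Finset α → ℝ) :
    EE ((a, b, p) :: L) f (c3 a b c Y x y z) =
      p * EE L f (c3 a b c Y y x z) + (1 - p) * EE L f (c3 a b c Y x y z) := by
  unfold c3
  rw [step_ab a b _ hab] <;> simp [mem_cd, ha, hb, hac, hbc]

theorem step3_bc (a b c : α) (Y : Finset α) (hab : a ≠ b) (hac : a ≠ c) (hbc : b ≠ c)
    (hb : b ∉ Y) (hc : c ∉ Y) (x y z : Bool)
    (p : ℝ) (L : List (α × α × ℝ)) (f : Finset α → ℝ) :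
    EE ((b, c, p) :: L) f (c3 a b c Y x y z) =
      p * EE L f (c3 a b c Y x z y) + (1 - p) * EE L f (c3 a b c Y x y z) := by
  have e : ∀ y z, c3 a b c Y x y z = cd y b ∪ cd z c ∪ (cd x a ∪ Y) := by
    intro y z; unfold c3; ac_rfl
  simp only [e]
  rw [step_ab b c _ hbc] <;> simp [mem_cd, hb, hc, hac.symm, hab.symm]

theorem mix3 (a b c : α) (hab : a ≠ b) (hac : a ≠ c) (hbc : b ≠ c) :
    Spec {a, b, c} {a, b, c} (M3 a b c) := by
  intro f C Y hC hY
  have ha : a ∉ Y := fun h => Finset.disjoint_left.1 hY (by simp) h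
  have hb : b ∉ Y := fun h => Finset.disjoint_left.1 hY (by simp) h
  have hc : c ∉ Y := fun h => Finset.disjoint_left.1 hY (by simp) h
  obtain ⟨x, y, z, rfl⟩ := sub3 a b c C hC
  have : cd x a ∪ cd y b ∪ cd z c ∪ Y = c3 a b c Y x y z := by
    unfold c3; ac_rfl
  rw [this]
  unfold M3
  simp only [step3_ab a b c Y hab hac hbc ha hb, step3_bc a b c Y hab hac hbc hb hc]
  cases x <;> cases y <;> cases z <;>
    simp [EE, AA, cd, c3, sumPC_single, sumPC_insert, sumPC_empty, hab, hac, hbc, hab.symm, hac.symm, hbc.symm,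
      Finset.insert_comm c a, Finset.insert_comm c b, Finset.insert_comm b a, Finset.pair_comm c a,
      Finset.pair_comm c b, Finset.pair_comm b a, Nat.choose] <;> ring

/-- full mixing list of four positions, without the first element -/
noncomputable def M4 (a b c d : α) : List (α × α × ℝ) :=
  [(b, c, 2/3), (a, b, 1/2), (c, d, 3/4), (b, c, 2/3), (a, b, 1/2)]

theorem step4_cd (a b c d : α) (Y : Finset α) (hac : a ≠ c) (hbc : b ≠ c) (had : a ≠ d)
    (hbd : b ≠ d) (hcd : c ≠ d)
    (hc : c ∉ Y) (hd : d ∉ Y) (x y z w : Bool)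
    (p : ℝ) (L : List (α × α × ℝ)) (f : Finset α → ℝ) :
    EE ((c, d, p) :: L) f (c4 a b c d Y x y z w) =
      p * EE L f (c4 a b c d Y x y w z) + (1 - p) * EE L f (c4 a b c d Y x y z w) := by
  have e : ∀ z w, c4 a b c d Y x y z w = cd z c ∪ cd w d ∪ (cd x a ∪ cd y b ∪ Y) := by
    intro y z; unfold c4; ac_rfl
  simp only [e]
  rw [step_ab c d _ hcd] <;>
    simp [mem_cd, hc, hd, hac.symm, hbc.symm, had.symm, hbd.symm]

theorem mix4 (a b c d : α) (hab : a ≠ b) (hac : a ≠ c) (had : a ≠ d) (hbc : b ≠ c)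
    (hbd : b ≠ d) (hcd : c ≠ d) :
    Spec {a, b, c, d} {a, b, c, d} ((a, b, 1/2) :: M4 a b c d) := by
  intro f C Y hC hY
  have ha : a ∉ Y := fun h => Finset.disjoint_left.1 hY (by simp) h
  have hb : b ∉ Y := fun h => Finset.disjoint_left.1 hY (by simp) h
  have hc : c ∉ Y := fun h => Finset.disjoint_left.1 hY (by simp) h
  have hd : d ∉ Y := fun h => Finset.disjoint_left.1 hY (by simp) h
  obtain ⟨x, y, z, w, rfl⟩ := sub4 a b c d C hC
  have : cd x a ∪ cd y b ∪ (cd z c ∪ cd w d) ∪ Y = c4 a b c d Y x y z w := by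
    unfold c4; ac_rfl
  rw [this]
  have h1 : ∀ (x y z w : Bool) (p : ℝ) (L : List (α × α × ℝ)) (f : Finset α → ℝ),
      EE ((a, b, p) :: L) f (c4 a b c d Y x y z w) =
      p * EE L f (c4 a b c d Y y x z w) + (1 - p) * EE L f (c4 a b c d Y x y z w) :=
    fun x y z w p L f => step3_ab a b c (cd w d ∪ Y) hab hac hbc
      (by simp [mem_cd, ha, had]) (by simp [mem_cd, hb, hbd]) x y z p L f
  have h2 : ∀ (x y z w : Bool) (p : ℝ) (L : List (α × α × ℝ)) (f : Finset α → ℝ),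
      EE ((b, c, p) :: L) f (c4 a b c d Y x y z w) =
      p * EE L f (c4 a b c d Y x z y w) + (1 - p) * EE L f (c4 a b c d Y x y z w) :=
    fun x y z w p L f => step3_bc a b c (cd w d ∪ Y) hab hac hbc
      (by simp [mem_cd, hb, hbd]) (by simp [mem_cd, hc, hcd]) x y z p L f
  have h3 := step4_cd a b c d Y hac hbc had hbd hcd hc hd
  unfold M4
  simp only [h1, h2, h3]
  cases x <;> cases y <;> cases z <;> cases w <;>
    simp [EE, AA, cd, c4, sumPC_single, sumPC_insert, sumPC_empty, hab, hac, hbc, had, hbd, hcd,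
      Finset.insert_comm c a, Finset.insert_comm c b, Finset.insert_comm b a, Finset.pair_comm c a,
      Finset.pair_comm c b, Finset.pair_comm b a, Finset.insert_comm d a, Finset.insert_comm d b,
      Finset.insert_comm d c, Finset.pair_comm d a, Finset.pair_comm d b, Finset.pair_comm d c,
      Nat.choose] <;> ring

theorem grow (M : List (α × α × ℝ)) (B : Finset α) (b : α) (hb : b ∈ B) (hM : Spec B B M)
    (hV : ∀ e ∈ M, VV e) (n : ℕ) : ∀ Q : Finset α, B ⊆ Q → Q.card = B.card + n →
    ∃ R : List (α × α × ℝ), (∀ e ∈ R, VV e) ∧ Spec Q B (M ++ R) ∧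
      R.length = n * (M.length + 1) := by
  induction n with
  | zero =>
    intro Q hQ hc
    have : B = Q := Finset.eq_of_subset_of_card_le hQ (by omega)
    subst this
    exact ⟨[], by simp, by simpa using hM, by simp⟩
  | succ n ih =>
    intro Q hQ hc
    obtain ⟨z, hz⟩ : (Q \ B).Nonempty := by
      apply Finset.card_pos.1
      rw [Finset.card_sdiff_of_subset hQ]; omega
    rw [Finset.mem_sdiff] at hz
    have hBQ : B ⊆ Q.erase z := by
      intro t ht
      rw [Finset.mem_erase]
      exact ⟨by rintro rfl; exact hz.2 ht, hQ ht⟩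
    have hce : (Q.erase z).card = B.card + n := by
      rw [Finset.card_erase_of_mem hz.1]; omega
    obtain ⟨R, h1, h2, h3⟩ := ih (Q.erase z) hBQ hce
    have := add_core (Q.erase z) B M (M ++ R) hM h2 hBQ b z hb (by simp)
    rw [Finset.insert_erase hz.1] at this
    refine ⟨_, ?_, this, ?_⟩
    · intro e he
      rw [List.mem_cons, List.mem_append] at he
      rcases he with rfl | he | he
      · refine ⟨?_, by positivity, ?_⟩
        · simp only; rintro rfl; exact hz.2 hb
        · simp only
          rw [div_le_one (by positivity), hce]
          push_cast
          have : (0 : ℝ) ≤ n := by positivity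
          linarith
      · exact hV e he
      · exact h1 e he
    · simp [h3]; ring

theorem list1 (Q : Finset α) (r : α) (hr : r ∈ Q) :
    ∃ L : List (α × α × ℝ), (∀ e ∈ L, VV e) ∧ Spec Q {r} L ∧ L.length = Q.card - 1 := by
  have : 0 < Q.card := Finset.card_pos.2 ⟨r, hr⟩
  obtain ⟨R, h1, h2, h3⟩ := grow [] {r} r (by simp) (mix1 r) (by simp) (Q.card - 1) Q
    (by simpa using hr) (by simp; omega)
  exact ⟨R, h1, by simpa using h2, by simpa using h3⟩

theorem list2 (Q : Finset α) (r s : α) (hr : r ∈ Q) (hs : s ∈ Q) (hrs : r ≠ s) (m : ℕ)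
    (hm : Q.card = m + 2) :
    ∃ L : List (α × α × ℝ), (∀ e ∈ L, VV e) ∧ Spec Q {r, s} L ∧ L.length = 2 * m + 1 := by
  obtain ⟨R, h1, h2, h3⟩ := grow [(r, s, 1/2)] {r, s} r (by simp) (mix2 r s hrs)
    (by intro e he; simp only [List.mem_singleton] at he; subst he; exact ⟨hrs, by norm_num, by norm_num⟩)
    m Q (by intro t; simp; rintro (rfl | rfl) <;> assumption)
    (by rw [Finset.card_pair hrs]; omega)
  refine ⟨_, ?_, h2, by simp [h3]; ring⟩
  intro e he
  simp only [List.mem_append, List.mem_singleton] at he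
  rcases he with rfl | he
  · exact ⟨hrs, by norm_num, by norm_num⟩
  · exact h1 e he

theorem mv (T : List (α × α × ℝ)) (f : Finset α → ℝ) (c r : α) (q : ℝ) (S W Y : Finset α)
    (h1 : c ∉ W) (h2 : c ∉ Y) (h3 : r ∉ S) (h4 : r ∉ W) (h5 : r ∉ Y) :
    EE ((c, r, q) :: T) f (S ∪ (W ∪ Y)) =
      if c ∈ S then q * EE T f (S.erase c ∪ (insert r W ∪ Y)) + (1 - q) * EE T f (S ∪ (W ∪ Y))
      else EE T f (S ∪ (W ∪ Y)) := by
  split_ifs with h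
  · rw [EE_move c r q T f S (W ∪ Y) h (by simp [h1, h2]) h3 (by simp [h4, h5]),
      Finset.insert_union]
  · rw [EE_stay c r q T f _ (by simp [h, h1, h2]) (by simp [h3, h4, h5])]

theorem ch3 (m : ℕ) (h : 3 ≤ m) : (m.choose 3 : ℝ) = m * (m - 1) * (m - 2) / 6 := by
  have := Nat.choose_succ_right_eq m 2
  have h2 : ((m.choose 3 * 3 : ℕ) : ℝ) = ((m.choose 2 * (m - 2) : ℕ) : ℝ) := by exact_mod_cast this
  push_cast [Nat.cast_sub (show 2 ≤ m by omega), Nat.cast_choose_two] at h2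
  linarith

theorem ch4 (m : ℕ) (h : 4 ≤ m) : (m.choose 4 : ℝ) = m * (m - 1) * (m - 2) * (m - 3) / 24 := by
  have := Nat.choose_succ_right_eq m 3
  have h2 : ((m.choose 4 * 4 : ℕ) : ℝ) = ((m.choose 3 * (m - 3) : ℕ) : ℝ) := by exact_mod_cast this
  push_cast [Nat.cast_sub (show 3 ≤ m by omega), ch3 m (by omega)] at h2
  linarith

theorem VV_M3 (a b c : α) (hab : a ≠ b) (hbc : b ≠ c) : ∀ e ∈ M3 a b c, VV e := by
  intro e he
  simp only [M3, List.mem_cons, List.not_mem_nil, or_false] at he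
  rcases he with rfl | rfl | rfl
  · exact ⟨hab, by norm_num, by norm_num⟩
  · exact ⟨hbc, by norm_num, by norm_num⟩
  · exact ⟨hab, by norm_num, by norm_num⟩

theorem VV_M4 (a b c d : α) (hab : a ≠ b) (hbc : b ≠ c) (hcd : c ≠ d) :
    ∀ e ∈ M4 a b c d, VV e := by
  intro e he
  simp only [M4, List.mem_cons, List.not_mem_nil, or_false] at he
  rcases he with rfl | rfl | rfl | rfl | rfl
  · exact ⟨hbc, by norm_num, by norm_num⟩
  · exact ⟨hab, by norm_num, by norm_num⟩
  · exact ⟨hcd, by norm_num, by norm_num⟩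
  · exact ⟨hbc, by norm_num, by norm_num⟩
  · exact ⟨hab, by norm_num, by norm_num⟩

theorem even3 (m : ℕ) (hm : 3 ≤ m) (P Q : Finset α) (hPQ : Disjoint P Q) (hP : P.card = m)
    (hQ : Q.card = m) (a b c : α) (ha : a ∈ P) (hb : b ∈ P) (hc : c ∈ P)
    (hab : a ≠ b) (hac : a ≠ c) (hbc : b ≠ c) (LP : List (α × α × ℝ)) (hLP : Spec P {a, b, c} LP)
    (hV : ∀ e ∈ LP, VV e) :
    ∃ L : List (α × α × ℝ), (∀ e ∈ L, VV e) ∧ Spec (P ∪ Q) {a, b, c} L ∧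
      L.length = LP.length + 2 * m + 3 := by
  obtain ⟨r, hr⟩ : Q.Nonempty := Finset.card_pos.1 (by omega)
  obtain ⟨LQ, q1, q2, q3⟩ := list1 Q r hr
  obtain ⟨F, f1, f2, hF⟩ := even_core m P Q {a, b, c} {r} hPQ hP hQ LP LQ hLP q2 (by simpa using hr)
  have hx : (3 : ℝ) ≤ m := by exact_mod_cast hm
  set al : ℝ := 3 * m / (2 * (2 * m - 1)) with hal
  have hBP : ({a, b, c} : Finset α) ⊆ P := by
    intro t; simp; rintro (rfl | rfl | rfl) <;> assumption
  have hrP : r ∉ P := fun h => Finset.disjoint_left.1 hPQ h hr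
  have hcr : c ≠ r := by rintro rfl; exact hrP hc
  refine ⟨M3 a b c ++ (c, r, al) :: (LP ++ (LQ ++ F)), ?_, ?_, ?_⟩
  · intro e he
    simp only [List.mem_append, List.mem_cons] at he
    rcases he with he | rfl | he | he | he
    · exact VV_M3 a b c hab hbc e he
    · refine ⟨hcr, ?_, ?_⟩
      · simp only [hal]; apply div_nonneg <;> linarith
      · simp only [hal]; rw [div_le_one (by linarith)]; linarith
    · exact hV e he
    · exact q1 e he
    · exact f2 e he
  · intro f C Y hC hY
    obtain ⟨H, hs, hE, hA⟩ := hF f Y hY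
    have hBY : Disjoint ({a, b, c} : Finset α) Y :=
      Finset.disjoint_of_subset_left (hBP.trans Finset.subset_union_left) hY
    rw [EE_append, mix3 a b c hab hac hbc _ C Y hC hBY]
    have hk : C.card ≤ 3 := (Finset.card_le_card hC).trans Finset.card_le_three
    have hcY : c ∉ Y := Finset.disjoint_left.1 hBY (by simp)
    have hrY : r ∉ Y := Finset.disjoint_left.1 hY (by simp [hr])
    rw [hA _ (by omega)]
    have key : ∀ S ⊆ ({a, b, c} : Finset α), EE ((c, r, al) :: (LP ++ (LQ ++ F))) f (S ∪ Y) =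
        if c ∈ S then al * H (S.card - 1) 1 + (1 - al) * H S.card 0 else H S.card 0 := by
      intro S hS
      have := mv (LP ++ (LQ ++ F)) f c r al S ∅ Y (by simp) hcY (fun h => hrP (hBP (hS h)))
        (by simp) hrY
      rw [hE S ∅ hS (by simp)] at this
      rw [Finset.empty_union] at this
      rw [this]
      split_ifs with h
      · rw [hE (S.erase c) (insert r ∅) ((Finset.erase_subset _ _).trans hS) (by simp),
          Finset.card_erase_of_mem h]
        simp
      · simp
    have key2 : AA C.card {a, b, c} (fun S => EE ((c, r, al) :: (LP ++ (LQ ++ F))) f (S ∪ Y)) =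
      AA C.card {a, b, c} (fun S => if c ∈ S then al * H (S.card - 1) 1 + (1 - al) * H S.card 0 else H S.card 0) := by
      unfold AA
      rw [Finset.sum_congr rfl]
      intro S hS
      exact key S (Finset.mem_powersetCard.1 hS).1
    rw [key2]
    clear key key2
    have e2 : ((2 * m).choose 2 : ℝ) = m * (2 * m - 1) := by
      rw [Nat.cast_choose_two]; push_cast; ring
    have e3 : ((2 * m).choose 3 : ℝ) = 2 * m * (2 * m - 1) * (2 * m - 2) / 6 := by
      rw [ch3 _ (by omega)]; push_cast; ring
    have e2' : (m.choose 2 : ℝ) = m * (m - 1) / 2 := by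
      rw [Nat.cast_choose_two]
    have e3' := ch3 m hm
    have z0 : (m : ℝ) ≠ 0 := by linarith
    have z1 : (2 * m - 1 : ℝ) ≠ 0 := by linarith
    have z2 : (m - 1 : ℝ) ≠ 0 := by linarith
    have z3 : (2 * m - 2 : ℝ) ≠ 0 := by linarith
    have z4 : (m * 2 - 1 : ℝ) ≠ 0 := by linarith
    have z5 : (m * 2 - 2 : ℝ) ≠ 0 := by linarith
    have hc3 : ({a, b, c} : Finset α).card = 3 := by
      rw [Finset.card_eq_three]; exact ⟨a, b, c, hab, hac, hbc, rfl⟩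
    generalize C.card = k at hk
    unfold AA
    rw [hc3]
    interval_cases k
    · simp [hac.symm, hbc.symm]
    · simp [sumPC_single, sumPC_insert, sumPC_empty, hab, hac, hbc, hab.symm, hac.symm, hbc.symm, Finset.Nat.antidiagonal_succ]
      rw [hs 0 1]; field_simp; ring
    · simp [sumPC_single, sumPC_insert, sumPC_empty, hab, hac, hbc, hab.symm, hac.symm, hbc.symm, Finset.Nat.antidiagonal_succ, e2, e2', Nat.choose]
      rw [hs 0 2, hal]; field_simp; ring
    · simp [sumPC_single, sumPC_insert, sumPC_empty, hab, hac, hbc, hab.symm, hac.symm, hbc.symm, Finset.Nat.antidiagonal_succ, e2', e3, e3', Nat.choose]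
      rw [hs 0 3, hs 1 2, hal]; field_simp; ring
  · simp [M3, q3, f1, hQ]; omega

theorem nn_of (x y : ℝ) (h1 : 0 ≤ x * y) (h2 : 0 ≤ x + y) : 0 ≤ x := by
  by_contra h
  push Not at h
  nlinarith

theorem exists_pq (x : ℝ) (hx : 4 ≤ x) : ∃ p q : ℝ, 0 ≤ p ∧ p ≤ 1 ∧ 0 ≤ q ∧ q ≤ 1 ∧
    p + q = x * (5 * x - 7) / ((2 * x - 1) * (2 * x - 3)) ∧
    p * q = 3 * x * (x - 1) / (2 * ((2 * x - 1) * (2 * x - 3))) := by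
  have hD : 0 < (2 * x - 1) * (2 * x - 3) := mul_pos (by linarith) (by linarith)
  have z1 : 2 * x - 1 ≠ 0 := by linarith
  have z2 : 2 * x - 3 ≠ 0 := by linarith
  set s : ℝ := x * (5 * x - 7) / ((2 * x - 1) * (2 * x - 3)) with hs
  set u : ℝ := 3 * x * (x - 1) / (2 * ((2 * x - 1) * (2 * x - 3))) with hu
  have hs0 : 0 ≤ s := div_nonneg (mul_nonneg (by linarith) (by linarith)) hD.le
  have hu0 : 0 ≤ u := div_nonneg (mul_nonneg (by linarith) (by linarith)) (by linarith)
  have hd : s ^ 2 - 4 * u = x * (x - 2) * (x ^ 2 + 4 * x - 9) / ((2 * x - 1) * (2 * x - 3)) ^ 2 := by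
    rw [eq_div_iff (by positivity), hs, hu]
    have : ((x * (5 * x - 7) / ((2 * x - 1) * (2 * x - 3))) ^ 2 - 4 * (3 * x * (x - 1) / (2 * ((2 * x - 1) * (2 * x - 3)))))
        * ((2 * x - 1) * (2 * x - 3)) ^ 2 = (x * (5 * x - 7)) ^ 2 - 6 * x * (x - 1) * ((2 * x - 1) * (2 * x - 3)) := by
      generalize (2 * x - 1) * (2 * x - 3) = D at hD
      field_simp; ring
    rw [this]; ring
  have hd0 : 0 ≤ s ^ 2 - 4 * u := by
    rw [hd]
    apply div_nonneg _ (by positivity)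
    apply mul_nonneg (mul_nonneg (by linarith) (by linarith)); nlinarith
  have hsum : 2 - s = 3 * (x - 1) * (x - 2) / ((2 * x - 1) * (2 * x - 3)) := by
    rw [eq_div_iff hD.ne', hs, sub_mul, div_mul_cancel₀ _ hD.ne']; ring
  have hprod : 1 - s + u = (x - 2) * (x - 3) / (2 * ((2 * x - 1) * (2 * x - 3))) := by
    rw [eq_div_iff (by positivity), add_mul, hu, div_mul_cancel₀ _ (by positivity), hs, sub_mul,
      mul_left_comm (_ / _) 2 _, div_mul_cancel₀ _ hD.ne']; ring
  have hsum0 : 0 ≤ 2 - s := by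
    rw [hsum]; apply div_nonneg (mul_nonneg (by linarith) (by linarith)) hD.le
  have hprod0 : 0 ≤ 1 - s + u := by
    rw [hprod]; apply div_nonneg (mul_nonneg (by linarith) (by linarith)) (by linarith)
  have hq := Real.sq_sqrt hd0
  set w := Real.sqrt (s ^ 2 - 4 * u)
  have e1 : (s + w) / 2 + (s - w) / 2 = s := by ring
  have e2 : (s + w) / 2 * ((s - w) / 2) = u := by nlinarith
  generalize (s + w) / 2 = p at e1 e2
  generalize (s - w) / 2 = q at e1 e2
  refine ⟨p, q, ?_, ?_, ?_, ?_, e1, e2⟩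
  · exact nn_of p q (by linarith) (by linarith)
  · have := nn_of (1 - p) (1 - q) (by nlinarith) (by linarith); linarith
  · exact nn_of q p (by linarith) (by linarith)
  · have := nn_of (1 - q) (1 - p) (by nlinarith) (by linarith); linarith

theorem even4 (m : ℕ) (hm : 4 ≤ m) (P Q : Finset α) (hPQ : Disjoint P Q) (hP : P.card = m)
    (hQ : Q.card = m) (a b c d : α) (ha : a ∈ P) (hb : b ∈ P) (hc : c ∈ P) (hd : d ∈ P)
    (hab : a ≠ b) (hac : a ≠ c) (had : a ≠ d) (hbc : b ≠ c) (hbd : b ≠ d) (hcd : c ≠ d)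
    (LP : List (α × α × ℝ)) (hLP : Spec P {a, b, c, d} LP)
    (hV : ∀ e ∈ LP, VV e) :
    ∃ R : List (α × α × ℝ), (∀ e ∈ R, VV e) ∧
      Spec (P ∪ Q) {a, b, c, d} ((a, b, 1/2) :: (M4 a b c d ++ R)) ∧
      R.length + 1 = LP.length + 3 * m := by
  obtain ⟨r, hr, s, hsQ, hrs⟩ := Finset.one_lt_card.1 (show 1 < Q.card by omega)
  obtain ⟨LQ, q1, q2, q3⟩ := list2 Q r s hr hsQ hrs (m - 2) (by omega)
  have hBQ : ({r, s} : Finset α) ⊆ Q := by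
    intro t; simp; rintro (rfl | rfl) <;> assumption
  obtain ⟨F, f1, f2, hF⟩ := even_core m P Q {a, b, c, d} {r, s} hPQ hP hQ LP LQ hLP q2 hBQ
  have hx : (4 : ℝ) ≤ m := by exact_mod_cast hm
  obtain ⟨p, q, p0, p1, q0, q1', hsum, hprod⟩ := exists_pq (m : ℝ) hx
  have hBP : ({a, b, c, d} : Finset α) ⊆ P := by
    intro t; simp; rintro (rfl | rfl | rfl | rfl) <;> assumption
  have hrP : r ∉ P := fun h => Finset.disjoint_left.1 hPQ h hr
  have hsP : s ∉ P := fun h => Finset.disjoint_left.1 hPQ h hsQ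
  have hdr : d ≠ r := by rintro rfl; exact hrP hd
  have hcs : c ≠ s := by rintro rfl; exact hsP hc
  have hcr : c ≠ r := by rintro rfl; exact hrP hc
  refine ⟨(d, r, p) :: (c, s, q) :: (LP ++ (LQ ++ F)), ?_, ?_, ?_⟩
  · intro e he
    simp only [List.mem_append, List.mem_cons] at he
    rcases he with rfl | rfl | he | he | he
    · exact ⟨hdr, p0, p1⟩
    · exact ⟨hcs, q0, q1'⟩
    · exact hV e he
    · exact q1 e he
    · exact f2 e he
  · intro f C Y hC hY
    obtain ⟨H, hs, hE, hA⟩ := hF f Y hY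
    have hBY : Disjoint ({a, b, c, d} : Finset α) Y :=
      Finset.disjoint_of_subset_left (hBP.trans Finset.subset_union_left) hY
    rw [← List.cons_append, EE_append, mix4 a b c d hab hac had hbc hbd hcd _ C Y hC hBY]
    have hk : C.card ≤ 4 := (Finset.card_le_card hC).trans Finset.card_le_four
    have hcY : c ∉ Y := Finset.disjoint_left.1 hBY (by simp)
    have hdY : d ∉ Y := Finset.disjoint_left.1 hBY (by simp)
    have hrY : r ∉ Y := Finset.disjoint_left.1 hY (by simp [hr])
    have hsY : s ∉ Y := Finset.disjoint_left.1 hY (by simp [hsQ])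
    rw [hA _ (by omega)]
    set T := LP ++ (LQ ++ F) with hT
    have key0 : ∀ S ⊆ ({a, b, c, d} : Finset α), ∀ W ⊆ ({r} : Finset α),
        EE ((c, s, q) :: T) f (S ∪ (W ∪ Y)) =
        if c ∈ S then q * H (S.card - 1) (W.card + 1) + (1 - q) * H S.card W.card
        else H S.card W.card := by
      intro S hS W hW
      have hsW : s ∉ W := fun h => hrs (Finset.mem_singleton.1 (hW h)).symm
      have hcW : c ∉ W := fun h => hcr (Finset.mem_singleton.1 (hW h))
      rw [mv T f c s q S W Y hcW hcY (fun h => hsP (hBP (hS h))) hsW hsY,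
        hE S W hS (hW.trans (by simp))]
      split_ifs with h
      · rw [hE (S.erase c) (insert s W) ((Finset.erase_subset _ _).trans hS), 
          Finset.card_erase_of_mem h, Finset.card_insert_of_notMem hsW]
        intro t ht
        rw [Finset.mem_insert] at ht
        rcases ht with rfl | ht
        · simp
        · have := hW ht; simp at this; simp [this]
      · rfl
    have key : ∀ S ⊆ ({a, b, c, d} : Finset α), EE ((d, r, p) :: (c, s, q) :: T) f (S ∪ Y) =
        if d ∈ S then p * (if c ∈ S then q * H (S.card - 2) 2 + (1 - q) * H (S.card - 1) 1
            else H (S.card - 1) 1)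
          + (1 - p) * (if c ∈ S then q * H (S.card - 1) 1 + (1 - q) * H S.card 0
            else H S.card 0)
        else (if c ∈ S then q * H (S.card - 1) 1 + (1 - q) * H S.card 0
            else H S.card 0) := by
      intro S hS
      have := mv ((c, s, q) :: T) f d r p S ∅ Y (by simp) hdY (fun h => hrP (hBP (hS h)))
        (by simp) hrY
      rw [key0 S hS ∅ (by simp)] at this
      rw [Finset.empty_union] at this
      rw [this]
      by_cases h : d ∈ S
      · rw [if_pos h, if_pos h, key0 (S.erase d) ((Finset.erase_subset _ _).trans hS) (insert r ∅) (by simp),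
          Finset.card_erase_of_mem h]
        simp [hcd, Nat.sub_sub]
      · rw [if_neg h, if_neg h]
        simp
    have key2 := fun (g : Finset α → ℝ) (h : ∀ S ⊆ ({a, b, c, d} : Finset α), EE ((d, r, p) :: (c, s, q) :: T) f (S ∪ Y) = g S) =>
      show AA C.card {a, b, c, d} (fun S => EE ((d, r, p) :: (c, s, q) :: T) f (S ∪ Y)) = AA C.card {a, b, c, d} g from by
        unfold AA
        rw [Finset.sum_congr rfl]
        intro S hS
        exact h S (Finset.mem_powersetCard.1 hS).1
    rw [key2 _ key]
    clear key key2 key0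
    have e2 : ((2 * m).choose 2 : ℝ) = m * (2 * m - 1) := by
      rw [Nat.cast_choose_two]; push_cast; ring
    have e3 : ((2 * m).choose 3 : ℝ) = m * (2 * m - 1) * (m - 1) * 2 / 3 := by
      rw [ch3 _ (by omega)]; push_cast; ring
    have e4 : ((2 * m).choose 4 : ℝ) = m * (2 * m - 1) * (m - 1) * (2 * m - 3) / 6 := by
      rw [ch4 _ (by omega)]; push_cast; ring
    have e2' : (m.choose 2 : ℝ) = m * (m - 1) / 2 := by
      rw [Nat.cast_choose_two]
    have e3' := ch3 m (by omega)
    have e4' := ch4 m (by omega)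
    have hc4 : ({a, b, c, d} : Finset α).card = 4 := by
      rw [Finset.card_insert_of_notMem, Finset.card_eq_three.2 ⟨b, c, d, hbc, hbd, hcd, rfl⟩]
      simp [hab, hac, had]
    have z0 : (m : ℝ) ≠ 0 := by linarith
    have z1 : 2 * (m : ℝ) - 1 ≠ 0 := by linarith
    have z2 : (m : ℝ) - 1 ≠ 0 := by linarith
    have z3 : 2 * (m : ℝ) - 3 ≠ 0 := by linarith
    have z4 : (m : ℝ) * 2 - 1 ≠ 0 := by linarith
    have z5 : (m : ℝ) * 2 - 3 ≠ 0 := by linarith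
    generalize C.card = k at hk
    unfold AA
    rw [hc4]
    have h02 := hs 0 2
    have h01 := hs 0 1
    have h03 := hs 0 3
    have h12 := hs 1 2
    have h04 := hs 0 4
    have h13 := hs 1 3
    interval_cases k
    · simp [hac.symm, hbc.symm]
    · simp [sumPC_single, sumPC_insert, sumPC_empty, hab, hac, had, hbc, hbd, hcd, hab.symm, hac.symm,
        had.symm, hbc.symm, hbd.symm, hcd.symm, Finset.Nat.antidiagonal_succ, e2, e3, e4, e2', e3', e4',
        Nat.choose, h01, h02, h03, h12, h04, h13]
      field_simp; ring
    · simp [sumPC_single, sumPC_insert, sumPC_empty, hab, hac, had, hbc, hbd, hcd, hab.symm, hac.symm,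
        had.symm, hbc.symm, hbd.symm, hcd.symm, Finset.Nat.antidiagonal_succ, e2, e3, e4, e2', e3', e4',
        Nat.choose, h01, h02, h03, h12, h04, h13]
      refine Eq.trans (b := (((6 - 3 * (p + q) + 2 * (p * q)) * H 2 0 + (3 * (p + q) - 2 * (p * q)) * H 1 1) / 6)) (by ring) ?_
      rw [hsum, hprod]; field_simp; ring
    · simp [sumPC_single, sumPC_insert, sumPC_empty, hab, hac, had, hbc, hbd, hcd, hab.symm, hac.symm,
        had.symm, hbc.symm, hbd.symm, hcd.symm, Finset.Nat.antidiagonal_succ, e2, e3, e4, e2', e3', e4',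
        Nat.choose, h01, h02, h03, h12, h04, h13]
      refine Eq.trans (b := (((4 - 3 * (p + q) + 2 * (p * q)) * H 3 0 + (3 * (p + q) - 2 * (p * q)) * H 2 1) / 4)) (by ring) ?_
      rw [hsum, hprod]; field_simp; ring
    · simp [sumPC_single, sumPC_insert, sumPC_empty, hab, hac, had, hbc, hbd, hcd, hab.symm, hac.symm,
        had.symm, hbc.symm, hbd.symm, hcd.symm, Finset.Nat.antidiagonal_succ, e2, e3, e4, e2', e3', e4',
        Nat.choose, h01, h02, h03, h12, h04, h13]
      refine Eq.trans (b := ((p * q) * H 2 2 + (p + q - 2 * (p * q)) * H 3 1 + (1 - (p + q) + p * q) * H 4 0)) (by ring) ?_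
      rw [hsum, hprod]; field_simp; ring
  · simp [q3, f1, hQ]; omega

theorem log_half (n : ℕ) (h : 2 ≤ n) : Nat.log 2 n = Nat.log 2 (n / 2) + 1 :=
  Nat.log_of_one_lt_of_le (by norm_num) h

theorem main3 (n : ℕ) : ∀ X : Finset α, X.card = n → 3 ≤ n → ∀ a b c : α, a ∈ X → b ∈ X → c ∈ X →
    a ≠ b → a ≠ c → b ≠ c → ∃ L : List (α × α × ℝ), (∀ e ∈ L, VV e) ∧ Spec X {a, b, c} L ∧
      L.length ≤ 2 * n + 5 * Nat.log 2 n := by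
  induction n using Nat.strong_induction_on with
  | _ n ih =>
  intro X hX hn a b c ha hb hc hab hac hbc
  have hc3 : ({a, b, c} : Finset α).card = 3 := by
    rw [Finset.card_eq_three]; exact ⟨a, b, c, hab, hac, hbc, rfl⟩
  have hBX : ({a, b, c} : Finset α) ⊆ X := by
    intro t; simp; rintro (rfl | rfl | rfl) <;> assumption
  have hlog := log_half n (by omega)
  by_cases h6 : n < 6
  · obtain ⟨R, h1, h2, h3⟩ := grow (M3 a b c) {a, b, c} c (by simp) (mix3 a b c hab hac hbc)
      (VV_M3 a b c hab hbc) (n - 3) X hBX (by omega)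
    refine ⟨_, ?_, h2, ?_⟩
    · intro e he
      rcases List.mem_append.1 he with he | he
      · exact VV_M3 a b c hab hbc e he
      · exact h1 e he
    · simp only [List.length_append, h3]
      simp [M3]
      omega
  push Not at h6
  obtain ⟨m, hm⟩ : ∃ m, m = n / 2 := ⟨_, rfl⟩
  rw [← hm] at hlog
  have even : ∀ X : Finset α, {a, b, c} ⊆ X → X.card = 2 * m → ∃ L : List (α × α × ℝ),
      (∀ e ∈ L, VV e) ∧ Spec X {a, b, c} L ∧ L.length ≤ 4 * m + 5 * Nat.log 2 m + 3 := by
    intro X hBX hX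
    obtain ⟨P, hP1, hP2, hP3⟩ := Finset.exists_subsuperset_card_eq hBX
      (show ({a, b, c} : Finset α).card ≤ m by omega) (by omega)
    obtain ⟨LP, l1, l2, l3⟩ := ih m (by omega) P hP3 (by omega) a b c (hP1 (by simp))
      (hP1 (by simp)) (hP1 (by simp)) hab hac hbc
    obtain ⟨L, k1, k2, k3⟩ := even3 m (by omega) P (X \ P) Finset.disjoint_sdiff hP3
      (by rw [Finset.card_sdiff_of_subset hP2]; omega) a b c (hP1 (by simp))
      (hP1 (by simp)) (hP1 (by simp)) hab hac hbc LP l2 l1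
    rw [Finset.union_sdiff_of_subset hP2] at k2
    exact ⟨L, k1, k2, by omega⟩
  rcases Nat.even_or_odd' n with ⟨m', h | h⟩
  · obtain ⟨L, k1, k2, k3⟩ := even X hBX (by omega)
    exact ⟨L, k1, k2, by omega⟩
  · obtain ⟨z, hz⟩ : (X \ {a, b, c}).Nonempty := by
      apply Finset.card_pos.1
      rw [Finset.card_sdiff_of_subset hBX]; omega
    rw [Finset.mem_sdiff] at hz
    have hBQ : {a, b, c} ⊆ X.erase z := by
      intro t ht
      rw [Finset.mem_erase]
      exact ⟨by rintro rfl; exact hz.2 ht, hBX ht⟩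
    have hce : (X.erase z).card = 2 * m := by
      rw [Finset.card_erase_of_mem hz.1]; omega
    obtain ⟨L, k1, k2, k3⟩ := even (X.erase z) hBQ hce
    have := add_core (X.erase z) {a, b, c} (M3 a b c) L (mix3 a b c hab hac hbc) k2 hBQ c z
      (by simp) (by simp)
    rw [Finset.insert_erase hz.1] at this
    refine ⟨_, ?_, this, ?_⟩
    · intro e he
      rw [List.mem_append, List.mem_cons] at he
      rcases he with he | rfl | he
      · exact VV_M3 a b c hab hbc e he
      · refine ⟨?_, by positivity, ?_⟩
        · simp only; rintro rfl; exact hz.2 (by simp)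
        · simp only
          rw [div_le_one (by positivity), hce, hc3]
          have : (3 : ℝ) ≤ m := by exact_mod_cast (by omega : 3 ≤ m)
          push_cast
          linarith
      · exact k1 e he
    · simp [M3]
      omega

theorem drop4 (a b c d z : α) (p : ℝ) (L : List (α × α × ℝ)) (had : a ≠ d) (hbd : b ≠ d)
    (haz : a ≠ z) (hbz : b ≠ z) (f : Finset α → ℝ) (C : Finset α) :
    EE (((a, b, 1/2) :: M4 a b c d) ++ (d, z, p) :: (a, b, 1/2) :: L) f C =
    EE ((a, b, 1/2) :: (M4 a b c d ++ (d, z, p) :: L)) f C := by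
  have key : ∀ S, EE ((a, b, 1/2) :: (d, z, p) :: (a, b, 1/2) :: L) f S =
      EE ((a, b, 1/2) :: (d, z, p) :: L) f S := by
    intro S
    have hc := image_swap_comm (a, b) (d, z) ⟨had, haz, hbd, hbz⟩
    simp only at hc
    have inv : ∀ S : Finset α, (S.image (Equiv.swap a b)).image (Equiv.swap a b) = S := by
      intro S; ext t; simp [mem_image_swap]
    simp only [EE, hc, inv]
    ring
  have e1 : ((a, b, (1/2 : ℝ)) :: M4 a b c d) ++ (d, z, p) :: (a, b, 1/2) :: L =
    [(a, b, 1/2), (b, c, 2/3), (a, b, 1/2), (c, d, 3/4), (b, c, 2/3)] ++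
      ((a, b, 1/2) :: (d, z, p) :: (a, b, 1/2) :: L) := by simp [M4]
  have e2 : (a, b, (1/2 : ℝ)) :: (M4 a b c d ++ (d, z, p) :: L) =
    [(a, b, 1/2), (b, c, 2/3), (a, b, 1/2), (c, d, 3/4), (b, c, 2/3)] ++
      ((a, b, 1/2) :: (d, z, p) :: L) := by simp [M4]
  rw [e1, e2, EE_append, EE_append]
  congr 1
  funext S
  exact key S

theorem main4 (n : ℕ) : ∀ X : Finset α, X.card = n → 4 ≤ n → ∀ a b c d : α, a ∈ X → b ∈ X →
    c ∈ X → d ∈ X → a ≠ b → a ≠ c → a ≠ d → b ≠ c → b ≠ d → c ≠ d →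
    ∃ L : List (α × α × ℝ), (∀ e ∈ L, VV e) ∧ Spec X {a, b, c, d} ((a, b, 1/2) :: L) ∧
      L.length + 1 ≤ 3 * n + 8 * Nat.log 2 n := by
  induction n using Nat.strong_induction_on with
  | _ n ih =>
  intro X hX hn a b c d ha hb hc hd hab hac had hbc hbd hcd
  have hc4 : ({a, b, c, d} : Finset α).card = 4 := by
    rw [Finset.card_insert_of_notMem, Finset.card_eq_three.2 ⟨b, c, d, hbc, hbd, hcd, rfl⟩]
    simp [hab, hac, had]
  have hBX : ({a, b, c, d} : Finset α) ⊆ X := by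
    intro t; simp; rintro (rfl | rfl | rfl | rfl) <;> assumption
  have hlog := log_half n (by omega)
  have hmix := mix4 a b c d hab hac had hbc hbd hcd
  have hvab : VV (a, b, (1/2 : ℝ)) := ⟨hab, by norm_num, by norm_num⟩
  have hvm := VV_M4 a b c d hab hbc hcd
  by_cases h8 : n < 8
  · obtain ⟨R, h1, h2, h3⟩ := grow ((a, b, 1/2) :: M4 a b c d) {a, b, c, d} c (by simp) hmix
      (by intro e he
          rcases List.mem_cons.1 he with rfl | he
          · exact hvab
          · exact hvm e he) (n - 4) X hBX (by omega)
    refine ⟨M4 a b c d ++ R, ?_, h2, ?_⟩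
    · intro e he
      rcases List.mem_append.1 he with he | he
      · exact hvm e he
      · exact h1 e he
    · simp only [List.length_append, h3]
      simp [M4]
      omega
  push Not at h8
  obtain ⟨m, hm⟩ : ∃ m, m = n / 2 := ⟨_, rfl⟩
  rw [← hm] at hlog
  have even : ∀ X : Finset α, {a, b, c, d} ⊆ X → X.card = 2 * m → ∃ L : List (α × α × ℝ),
      (∀ e ∈ L, VV e) ∧ Spec X {a, b, c, d} ((a, b, 1/2) :: L) ∧
        L.length + 1 ≤ 6 * m + 8 * Nat.log 2 m + 5 := by
    intro X hBX hX
    obtain ⟨P, hP1, hP2, hP3⟩ := Finset.exists_subsuperset_card_eq hBX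
      (show ({a, b, c, d} : Finset α).card ≤ m by omega) (by omega)
    obtain ⟨LP, l1, l2, l3⟩ := ih m (by omega) P hP3 (by omega) a b c d (hP1 (by simp))
      (hP1 (by simp)) (hP1 (by simp)) (hP1 (by simp)) hab hac had hbc hbd hcd
    obtain ⟨L, k1, k2, k3⟩ := even4 m (by omega) P (X \ P) Finset.disjoint_sdiff hP3
      (by rw [Finset.card_sdiff_of_subset hP2]; omega) a b c d (hP1 (by simp))
      (hP1 (by simp)) (hP1 (by simp)) (hP1 (by simp)) hab hac had hbc hbd hcd _ l2
      (by intro e he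
          rcases List.mem_cons.1 he with rfl | he
          · exact hvab
          · exact l1 e he)
    rw [Finset.union_sdiff_of_subset hP2] at k2
    refine ⟨_, ?_, k2, ?_⟩
    · intro e he
      rcases List.mem_append.1 he with he | he
      · exact hvm e he
      · exact k1 e he
    · simp only [List.length_append, List.length_cons] at k3 ⊢
      simp only [M4, List.length_cons, List.length_nil]
      omega
  rcases Nat.even_or_odd' n with ⟨m', h | h⟩
  · obtain ⟨L, k1, k2, k3⟩ := even X hBX (by omega)
    exact ⟨L, k1, k2, by omega⟩
  · obtain ⟨z, hz⟩ : (X \ {a, b, c, d}).Nonempty := by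
      apply Finset.card_pos.1
      rw [Finset.card_sdiff_of_subset hBX]; omega
    rw [Finset.mem_sdiff] at hz
    have hBQ : {a, b, c, d} ⊆ X.erase z := by
      intro t ht
      rw [Finset.mem_erase]
      exact ⟨by rintro rfl; exact hz.2 ht, hBX ht⟩
    have hce : (X.erase z).card = 2 * m := by
      rw [Finset.card_erase_of_mem hz.1]; omega
    obtain ⟨L, k1, k2, k3⟩ := even (X.erase z) hBQ hce
    have := add_core (X.erase z) {a, b, c, d} ((a, b, 1/2) :: M4 a b c d) ((a, b, 1/2) :: L) hmix
      k2 hBQ d z (by simp) (by simp)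
    rw [Finset.insert_erase hz.1] at this
    have haz : a ≠ z := by rintro rfl; exact hz.2 (by simp)
    have hbz : b ≠ z := by rintro rfl; exact hz.2 (by simp)
    refine ⟨M4 a b c d ++ (d, z, (({a, b, c, d} : Finset α).card : ℝ) / ((X.erase z).card + 1)) :: L,
      ?_, ?_, ?_⟩
    · intro e he
      rw [List.mem_append, List.mem_cons] at he
      rcases he with he | rfl | he
      · exact hvm e he
      · refine ⟨?_, by positivity, ?_⟩
        · simp only; rintro rfl; exact hz.2 (by simp)
        · simp only
          rw [div_le_one (by positivity), hce, hc4]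
          have : (4 : ℝ) ≤ m := by exact_mod_cast (by omega : 4 ≤ m)
          push_cast
          linarith
      · exact k1 e he
    · intro f C Y hC hY
      rw [← drop4 a b c d z _ L had hbd haz hbz]
      exact this f C Y hC hY
    · simp [M4]
      omega

theorem occ_EE {n : ℕ} (L : List (LazyT n)) (S C : Finset (Fin n)) :
    (∑ σ : Equiv.Perm (Fin n), if C.image σ = S then permDist L σ else 0) =
      EE L (fun T => if T = S then 1 else 0) C := by
  induction L generalizing C with
  | nil =>
    simp only [permDist, EE]
    rw [Finset.sum_eq_single (1 : Equiv.Perm (Fin n))]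
    · simp
    · intro σ _ h; simp [h]
    · simp
  | cons e L ih =>
    simp only [permDist, EE, ← ih]
    rw [Finset.mul_sum, Finset.mul_sum]
    have : (∑ σ : Equiv.Perm (Fin n), e.2.2 *
        if (C.image (Equiv.swap e.1 e.2.1)).image σ = S then permDist L σ else 0) =
      ∑ σ : Equiv.Perm (Fin n), e.2.2 *
        if C.image σ = S then permDist L (σ * Equiv.swap e.1 e.2.1) else 0 := by
      symm
      apply Fintype.sum_equiv (Equiv.mulRight (Equiv.swap e.1 e.2.1))
      intro σ
      rw [Finset.image_image]
      have : (⇑((Equiv.mulRight (Equiv.swap e.1 e.2.1)) σ) ∘ ⇑(Equiv.swap e.1 e.2.1)) = ⇑σ := by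
        funext t; simp
      rw [this]; rfl
    rw [this, ← Finset.sum_add_distrib]
    apply Finset.sum_congr rfl
    intro σ _
    split_ifs <;> ring

theorem finish {n t : ℕ} (ht : t ≤ n) (L : List (LazyT n)) (B : Finset (Fin n))
    (hB : Finset.image (fun i : Fin t => Fin.castLE ht i) Finset.univ = B)
    (hL : Spec Finset.univ B L) (hV : ∀ e ∈ L, VV e) : Uhat t n ≤ L.length := by
  apply Nat.sInf_le
  refine ⟨ht, L, rfl, hV, ?_⟩
  intro S hS
  have hc : B.card = t := by
    rw [← hB, Finset.card_image_of_injective _ (Fin.castLE_injective ht)]; simp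
  have h1 : occProb ht L S = EE L (fun T => if T = S then 1 else 0) B := by
    rw [← occ_EE, ← hB]
    unfold occProb
    apply Finset.sum_congr rfl
    intro σ _
    rw [Finset.image_image]; rfl
  have h2 := hL (fun T => if T = S then 1 else 0) B ∅ (Finset.Subset.refl _) (by simp)
  rw [Finset.union_empty] at h2
  rw [h1, h2, hc]
  unfold AA
  simp only [Finset.union_empty, Finset.card_univ, Fintype.card_fin]
  rw [Finset.sum_ite_eq', if_pos]
  rw [Finset.mem_powersetCard]
  exact ⟨Finset.subset_univ _, hS⟩

theorem log_cast (n : ℕ) : (Nat.log 2 n : ℝ) ≤ Real.logb 2 n := by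
  exact_mod_cast Real.natLog_le_logb n 2

end Aux

theorem Uhat_asymptotics :
    (∀ n : ℕ, 3 ≤ n → (Uhat 3 n : ℝ) ≤ 2 * n + 5 * Real.logb 2 n) ∧
    (∀ n : ℕ, 4 ≤ n → (Uhat 4 n : ℝ) ≤ 3 * n + 8 * Real.logb 2 n) := by
  constructor
  · intro n hn
    obtain ⟨L, h1, h2, h3⟩ := main3 n (Finset.univ : Finset (Fin n)) (by simp) hn
      ⟨0, by omega⟩ ⟨1, by omega⟩ ⟨2, by omega⟩ (by simp) (by simp) (by simp)
      (by simp) (by simp) (by simp)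
    have h4 := finish hn L _ (by
      ext x
      simp [Fin.exists_fin_succ, Fin.ext_iff, eq_comm]) h2 h1
    have h5 : ((Uhat 3 n : ℕ) : ℝ) ≤ ((2 * n + 5 * Nat.log 2 n : ℕ) : ℝ) := by
      exact_mod_cast h4.trans h3
    have h6 := log_cast n
    push_cast at h5
    linarith
  · intro n hn
    obtain ⟨L, h1, h2, h3⟩ := main4 n (Finset.univ : Finset (Fin n)) (by simp) hn
      ⟨0, by omega⟩ ⟨1, by omega⟩ ⟨2, by omega⟩ ⟨3, by omega⟩ (by simp) (by simp) (by simp)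
      (by simp) (by simp) (by simp) (by simp) (by simp) (by simp) (by simp)
    have h4 := finish hn _ _ (by
      ext x
      simp [Fin.exists_fin_succ, Fin.ext_iff, eq_comm]) h2 (by
        intro e he
        rcases List.mem_cons.1 he with rfl | he
        · exact ⟨by simp, by norm_num, by norm_num⟩
        · exact h1 e he)
    have h5 : ((Uhat 4 n : ℕ) : ℝ) ≤ ((3 * n + 8 * Nat.log 2 n : ℕ) : ℝ) := by
      exact_mod_cast h4.trans (by simpa using h3)
    have h6 := log_cast n
    push_cast at h5
    linarith
end
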